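/- Let 0 ≤ s < 1 and ε > 0. There exist ε' > 0 and C > 0 depending only on s and ε such that: for every N ≥ 2, every admissible low symbol m (with parameters N, s) with associated multiplier I, every t₀ ∈ ℝ, every 0 < δ ≤ 1, and all Schwartz functions u₁, u₂, u₃, u₄ : ℝ×ℝ→ℂ, one has |∫_{t₀}^{t₀+δ} Λ₄(M₄'; u₁(·,t), \overline{u₂(·,t)}, u₃(·,t), \overline{u₄(·,t)}) dt| ≤ C N^{−1+ε} ∏_{i=1}^4 ‖I uᵢ‖_{X^{1,1/2+ε'}}, where M₄'(ξ₁,ξ₂,ξ₃,ξ₄) := ξ₁² m(ξ₁) ( m(ξ₂) m(ξ₃) m(ξ₄) − m(ξ₂+ξ₃+ξ₄) ). -/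

import Mathlib

open MeasureTheory Real

noncomputable section

/-- The Fourier transform on `ℝ`: `f̂(ξ) = ∫ e^{-ixξ} f(x) dx`. -/
def ft (f : ℝ → ℂ) (ξ : ℝ) : ℂ := ∫ x : ℝ, Complex.exp (-Complex.I * x * ξ) * f x

/-- The Japanese bracket `⟨ξ⟩ = 1 + |ξ|`. -/
def jap (ξ : ℝ) : ℝ := 1 + |ξ|

/-- The Sobolev norm `‖f‖_{H^s} = (∫ ⟨ξ⟩^{2s} |f̂(ξ)|² dξ)^{1/2}`. -/
def HsNorm (s : ℝ) (f : ℝ → ℂ) : ℝ :=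
  (∫ ξ : ℝ, jap ξ ^ (2 * s) * ‖ft f ξ‖ ^ 2) ^ ((1 : ℝ) / 2)

/-- The squared `L²` norm. -/
def L2sq (f : ℝ → ℂ) : ℝ := ∫ x : ℝ, ‖f x‖ ^ 2

/-- The spacetime Fourier transform (x first variable, t second). -/
def stft (u : ℝ → ℝ → ℂ) (ξ τ : ℝ) : ℂ :=
  ∫ t : ℝ, ∫ x : ℝ, Complex.exp (-Complex.I * (x * ξ + t * τ)) * u x t

/-- The `X^{s,b}` norm. -/
def XsbNorm (s b : ℝ) (u : ℝ → ℝ → ℂ) : ℝ :=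
  (∫ ξ : ℝ, ∫ τ : ℝ,
    jap ξ ^ (2 * s) * jap (τ - ξ ^ 2) ^ (2 * b) * ‖stft u ξ τ‖ ^ 2) ^ ((1 : ℝ) / 2)

/-- The Fourier multiplier with symbol `θ`: `(mult θ f)̂(ξ) = θ(ξ) f̂(ξ)`. -/
def mult (θ : ℝ → ℝ) (f : ℝ → ℂ) (x : ℝ) : ℂ :=
  (2 * π)⁻¹ • ∫ ξ : ℝ, Complex.exp (Complex.I * x * ξ) * (θ ξ : ℂ) * ft f ξ

/-- The multiplier applied in the `x`-variable of a spacetime function. -/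
def multX (θ : ℝ → ℝ) (u : ℝ → ℝ → ℂ) (x t : ℝ) : ℂ := mult θ (fun y => u y t) x

/-- The cubic nonlinearity `F(z) = |z|² z`. -/
def Fnl (z : ℂ) : ℂ := (‖z‖ : ℂ) ^ 2 * z

/-- The real inner product `⟨f,g⟩ = Re ∫ f ḡ`. -/
def rip (f g : ℝ → ℂ) : ℝ := (∫ x : ℝ, f x * (starRingEnd ℂ) (g x)).re

/-- The Lyapunov functional `L(u) = ∫ |∂ₓu|² + |u|² - ½|u|⁴`. -/
def Lfun (f : ℝ → ℂ) : ℝ :=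
  ∫ x : ℝ, (‖deriv f x‖ ^ 2 + ‖f x‖ ^ 2
    - (1 / 2) * ‖f x‖ ^ 4)

/-- The Lyapunov functional with the `H¹`-part expressed on the Fourier side
(Plancherel form), suitable for `H¹` functions. -/
def LfunH1 (f : ℝ → ℂ) : ℝ :=
  (2 * π)⁻¹ * (∫ ξ : ℝ, (ξ ^ 2 + 1) * ‖ft f ξ‖ ^ 2)
    - (1 / 2) * ∫ x : ℝ, ‖f x‖ ^ 4

/-- Membership in `H¹(ℝ)`. -/
def MemH1 (f : ℝ → ℂ) : Prop :=
  MemLp f 2 (volume : Measure ℝ) ∧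
    Integrable (fun ξ : ℝ => jap ξ ^ (2 : ℝ) * ‖ft f ξ‖ ^ 2)

/-- The ground state `Q(x) = 2^{-1/2} / cosh x`. -/
def Qgs (x : ℝ) : ℝ := (Real.sqrt 2)⁻¹ / Real.cosh x

/-- A point `e^{iα} Q(· - x₀)` of the ground state cylinder. -/
def Qcyl (α x₀ : ℝ) (x : ℝ) : ℂ := Complex.exp (Complex.I * α) * (Qgs (x - x₀) : ℂ)

/-- The ground state cylinder `Σ`. -/
def groundCyl : Set (ℝ → ℂ) := { f | ∃ α x₀ : ℝ, f = Qcyl α x₀ }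

/-- `dist_{H^s}(f, Σ)`. -/
def distHs (s : ℝ) (f : ℝ → ℂ) : ℝ :=
  ⨅ v ∈ groundCyl, HsNorm s (fun x => f x - v x)

/-- A smooth function `u(x,t)` all of whose `x`-derivatives are rapidly decreasing
in `x`, locally uniformly in `t`. -/
structure IsSchwartzInX (u : ℝ → ℝ → ℂ) : Prop where
  smooth : ContDiff ℝ (⊤ : ℕ∞) (fun p : ℝ × ℝ => u p.1 p.2)
  decay : ∀ (k n : ℕ) (T : ℝ), 0 < T → ∃ C : ℝ, ∀ x t : ℝ, |t| ≤ T →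
    |x| ^ k * ‖iteratedDeriv n (fun y => u y t) x‖ ≤ C

/-- A smooth Schwartz solution of the focusing cubic NLS `iu_t + u_xx = -|u|²u`. -/
structure IsSchwartzSolution (u : ℝ → ℝ → ℂ) extends IsSchwartzInX u : Prop where
  eqn : ∀ x t : ℝ, Complex.I * deriv (fun τ => u x τ) t
      + iteratedDeriv 2 (fun y => u y t) x
      = -((‖u x t‖ : ℂ) ^ 2 * u x t)

/-- A Schwartz function on spacetime. -/
def IsSchwartz2 (u : ℝ → ℝ → ℂ) : Prop :=
  ∃ g : SchwartzMap (ℝ × ℝ) ℂ, ∀ x t : ℝ, u x t = g (x, t)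

/-- An admissible high symbol `θ` with parameters `N`, `s`. -/
structure AdmissibleHigh (N s : ℝ) (θ : ℝ → ℝ) : Prop where
  smooth : ContDiff ℝ (⊤ : ℕ∞) θ
  even : ∀ ξ : ℝ, θ (-ξ) = θ ξ
  eq_one : ∀ ξ : ℝ, |ξ| ≤ N → θ ξ = 1
  eq_high : ∀ ξ : ℝ, 2 * N ≤ |ξ| → θ ξ = |ξ| ^ s * N ^ (-s)
  mono : ∀ ξ η : ℝ, |ξ| ≤ |η| → θ ξ ≤ θ η
  deriv1 : ∀ ξ : ℝ, |deriv (fun ζ => θ ζ ^ 2) ξ| ≤ 10 * θ ξ ^ 2 / jap ξ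
  deriv2 : ∀ ξ : ℝ, |iteratedDeriv 2 (fun ζ => θ ζ ^ 2) ξ| ≤ 10 * θ ξ ^ 2 / jap ξ ^ 2

/-- An admissible low symbol `m` with parameters `N`, `s`. -/
structure AdmissibleLow (N s : ℝ) (m : ℝ → ℝ) : Prop where
  smooth : ContDiff ℝ (⊤ : ℕ∞) m
  even : ∀ ξ : ℝ, m (-ξ) = m ξ
  eq_one : ∀ ξ : ℝ, |ξ| ≤ N → m ξ = 1
  eq_high : ∀ ξ : ℝ, 2 * N ≤ |ξ| → m ξ = |ξ| ^ (s - 1) * N ^ (1 - s)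
  anti : ∀ ξ η : ℝ, |ξ| ≤ |η| → m η ≤ m ξ
  mono : ∀ ξ η : ℝ, |ξ| ≤ |η| → m ξ * jap ξ ≤ m η * jap η
  deriv1 : ∀ ξ : ℝ, |deriv m ξ| ≤ 10 * m ξ / jap ξ
  deriv2 : ∀ ξ : ℝ, |iteratedDeriv 2 m ξ| ≤ 10 * m ξ / jap ξ ^ 2

/-- The multilinear form `Λ₄` on the hyperplane `ξ₁+ξ₂+ξ₃+ξ₄ = 0`. -/
def Lam4 (M : ℝ → ℝ → ℝ → ℝ → ℝ) (f₁ f₂ f₃ f₄ : ℝ → ℂ) : ℂ :=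
  ∫ ξ₁ : ℝ, ∫ ξ₂ : ℝ, ∫ ξ₃ : ℝ,
    (M ξ₁ ξ₂ ξ₃ (-(ξ₁ + ξ₂ + ξ₃)) : ℂ) * ft f₁ ξ₁ * ft f₂ ξ₂ * ft f₃ ξ₃
      * ft f₄ (-(ξ₁ + ξ₂ + ξ₃))

/-- The multilinear form `Λ₆` on the hyperplane `ξ₁+⋯+ξ₆ = 0`. -/
def Lam6 (M : ℝ → ℝ → ℝ → ℝ → ℝ → ℝ → ℝ) (f₁ f₂ f₃ f₄ f₅ f₆ : ℝ → ℂ) : ℂ :=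
  ∫ ξ₁ : ℝ, ∫ ξ₂ : ℝ, ∫ ξ₃ : ℝ, ∫ ξ₄ : ℝ, ∫ ξ₅ : ℝ,
    (M ξ₁ ξ₂ ξ₃ ξ₄ ξ₅ (-(ξ₁ + ξ₂ + ξ₃ + ξ₄ + ξ₅)) : ℂ) * ft f₁ ξ₁ * ft f₂ ξ₂
      * ft f₃ ξ₃ * ft f₄ ξ₄ * ft f₅ ξ₅ * ft f₆ (-(ξ₁ + ξ₂ + ξ₃ + ξ₄ + ξ₅))

/-- The complex conjugate of a function. -/
def cj (f : ℝ → ℂ) : ℝ → ℂ := fun x => (starRingEnd ℂ) (f x)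

open scoped ENNReal FourierTransform

theorem one_le_jap (x : ℝ) : 1 ≤ jap x := by
  unfold jap
  linarith [abs_nonneg x]

theorem jap_pos (x : ℝ) : 0 < jap x := zero_lt_one.trans_le (one_le_jap x)

theorem jap_neg (x : ℝ) : jap (-x) = jap x := by
  simp [jap]

namespace AdmissibleLow

variable {N s : ℝ} {m : ℝ → ℝ}

theorem one_le_mul_jap (hN : 2 ≤ N) (h : AdmissibleLow N s m) (x : ℝ) : 1 ≤ m x * jap x := by
  have h0 : m 0 = 1 := h.eq_one 0 (by rw [abs_zero]; linarith)
  have := h.mono 0 x (by rw [abs_zero]; exact abs_nonneg x)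
  simpa [h0, jap] using this

theorem pos (hN : 2 ≤ N) (h : AdmissibleLow N s m) (x : ℝ) : 0 < m x :=
  pos_of_mul_pos_left (zero_lt_one.trans_le (h.one_le_mul_jap hN x)) (jap_pos x).le

theorem le_one (hN : 2 ≤ N) (h : AdmissibleLow N s m) (x : ℝ) : m x ≤ 1 := by
  have h0 : m 0 = 1 := h.eq_one 0 (by rw [abs_zero]; linarith)
  have := h.anti 0 x (by rw [abs_zero]; exact abs_nonneg x)
  rwa [h0] at this

/-- A frequency `x` controlled by `3⟨y⟩` has a weight controlled by that of `y`. -/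
theorem mul_jap_le_three (hN : 2 ≤ N) (h : AdmissibleLow N s m) {x y : ℝ}
    (hxy : jap x ≤ 3 * jap y) : m x * jap x ≤ 3 * (m y * jap y) := by
  rcases le_total |x| |y| with hle | hle
  · have := h.mono x y hle
    linarith [h.one_le_mul_jap hN y]
  · have h1 := h.anti y x hle
    have h2 : m x * jap x ≤ m y * (3 * jap y) :=
      mul_le_mul h1 hxy (jap_pos x).le (h.pos hN y).le
    linarith

/-- Two points whose distance is at most half the size of one of them: the symbol varies
at most linearly. -/
theorem abs_sub_le (hN : 2 ≤ N) (h : AdmissibleLow N s m) {x d : ℝ} (hd : 2 * |d| ≤ |x|) :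
    |m (x + d) - m x| ≤ 40 * m x / jap x * |d| := by
  wlog hx : 0 ≤ x generalizing x d
  · have := this (x := -x) (d := -d) (by simpa using hd) (by linarith)
    rw [← neg_add, h.even, h.even, jap_neg, abs_neg] at this
    exact this
  rw [abs_of_nonneg hx] at hd
  have hd1 := abs_le.1 (show |d| ≤ x / 2 by linarith)
  have hmean := (convex_Ici (x / 2)).norm_image_sub_le_of_norm_deriv_le (f := m)
    (C := 40 * m x / jap x) (x := x) (y := x + d)
    (fun y _ => (h.smooth.differentiable (by simp)).differentiableAt) (fun y hy => ?_)
    (by simp only [Set.mem_Ici]; linarith) (by simp only [Set.mem_Ici]; linarith)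
  · simpa using hmean
  · have hy' : x / 2 ≤ y := hy
    have hx2 : |x / 2| = x / 2 := abs_of_nonneg (by linarith)
    have hyy : |y| = y := abs_of_nonneg (by linarith)
    have h1 : m y ≤ m (x / 2) := h.anti _ _ (by rw [hx2, hyy]; exact hy')
    have h2 : m (x / 2) * jap (x / 2) ≤ m x * jap x :=
      h.mono _ _ (by rw [hx2, abs_of_nonneg hx]; linarith)
    have hj1 : jap (x / 2) = 1 + x / 2 := by rw [jap, hx2]
    have hj2 : jap x = 1 + x := by rw [jap, abs_of_nonneg hx]
    have hj3 : jap y = 1 + y := by rw [jap, hyy]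
    rw [hj1, hj2] at h2
    have hmx := h.pos hN x
    have h3 : m (x / 2) ≤ 2 * m x := by
      by_contra hcon
      push Not at hcon
      nlinarith
    rw [norm_eq_abs]
    refine (h.deriv1 y).trans ?_
    rw [hj2, hj3, div_le_div_iff₀ (by linarith) (by linarith)]
    have h4 : m y ≤ 2 * m x := h1.trans h3
    have h5 : 1 + x ≤ 2 * (1 + y) := by linarith
    have := mul_le_mul h4 h5 (by linarith) (by linarith)
    linarith

theorem symbol_bound_sorted (hN : 2 ≤ N) (h : AdmissibleLow N s m) {x₁ x₂ x₃ x₄ : ℝ}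
    (hsum : x₁ + x₂ + x₃ + x₄ = 0) (h32 : |x₃| ≤ |x₂|) (h43 : |x₄| ≤ |x₃|) :
    |x₁ ^ 2 * m x₁ * (m x₂ * m x₃ * m x₄ - m x₁)| ≤
      720 / N * ((m x₁ * jap x₁) * (m x₂ * jap x₂) * (m x₃ * jap x₃) * (m x₄ * jap x₄)) := by
  have hx1 : x₁ = -(x₂ + (x₃ + x₄)) := by linarith
  have hN0 : 0 < N := by linarith
  have hp1 := h.pos hN x₁
  have hp2 := h.pos hN x₂
  have hp3 := h.pos hN x₃
  have hp4 := h.pos hN x₄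
  have hl3 := h.le_one hN x₃
  have hl4 := h.le_one hN x₄
  have hJ1 := h.one_le_mul_jap hN x₁
  have hJ2 := h.one_le_mul_jap hN x₂
  have hJ3 := h.one_le_mul_jap hN x₃
  have hJ4 := h.one_le_mul_jap hN x₄
  have habs : |x₁| ≤ |x₂| + |x₃ + x₄| := by
    rw [hx1, abs_neg]; exact abs_add_le _ _
  have habs34 : |x₃ + x₄| ≤ |x₃| + |x₄| := abs_add_le _ _
  have hjap1 : jap x₁ ≤ 3 * jap x₂ := by unfold jap; linarith
  have hJ12 : m x₁ * jap x₁ ≤ 3 * (m x₂ * jap x₂) := h.mul_jap_le_three hN hjap1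
  have hx1j : x₁ ^ 2 ≤ jap x₁ ^ 2 := by
    rw [← sq_abs x₁]
    exact pow_le_pow_left₀ (abs_nonneg _) (by unfold jap; linarith) 2
  have hj1 := jap_pos x₁
  have hj2 := jap_pos x₂
  rcases le_or_gt (|x₂| + |x₃| + |x₄|) N with hlow | hlow
  · have e1 := h.eq_one x₁ (by linarith)
    have e2 := h.eq_one x₂ (by linarith [abs_nonneg x₃, abs_nonneg x₄])
    have e3 := h.eq_one x₃ (by linarith [abs_nonneg x₂, abs_nonneg x₄])
    have e4 := h.eq_one x₄ (by linarith [abs_nonneg x₃, abs_nonneg x₂])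
    have hj3 := jap_pos x₃
    have hj4 := jap_pos x₄
    rw [e1, e2, e3, e4]
    simp only [mul_one, sub_self, mul_zero, abs_zero, one_mul]
    positivity
  rcases le_or_gt (N / 12) |x₃| with h3 | h3
  · have hJ3N : N ≤ 12 * (m x₃ * jap x₃) := by
      have hq : |N / 12| = N / 12 := abs_of_pos (by linarith)
      have := h.mono (N / 12) x₃ (by rw [hq]; exact h3)
      rw [h.eq_one (N / 12) (by rw [hq]; linarith), one_mul, jap, hq] at this
      linarith
    have hb : |m x₂ * m x₃ * m x₄ - m x₁| ≤ m x₂ + m x₁ := by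
      have : m x₂ * m x₃ * m x₄ ≤ m x₂ := by
        rw [mul_assoc]
        exact mul_le_of_le_one_right hp2.le (mul_le_one₀ hl3 hp4.le hl4)
      have h0 : 0 < m x₂ * m x₃ * m x₄ := by positivity
      rw [abs_le]; constructor <;> linarith
    have hc : jap x₁ * (m x₂ + m x₁) ≤ 6 * (m x₂ * jap x₂) := by
      have := mul_le_mul_of_nonneg_left hjap1 hp2.le
      linarith
    rw [abs_mul, abs_of_nonneg (by positivity : 0 ≤ x₁ ^ 2 * m x₁)]
    calc x₁ ^ 2 * m x₁ * |m x₂ * m x₃ * m x₄ - m x₁|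
        ≤ jap x₁ ^ 2 * m x₁ * (m x₂ + m x₁) := by gcongr
      _ = (m x₁ * jap x₁) * (jap x₁ * (m x₂ + m x₁)) := by ring
      _ ≤ (m x₁ * jap x₁) * (6 * (m x₂ * jap x₂)) := by gcongr
      _ ≤ (m x₁ * jap x₁) * (6 * (m x₂ * jap x₂)) * (12 * (m x₃ * jap x₃) / N)
            * (m x₄ * jap x₄) := by
          have : 1 ≤ 12 * (m x₃ * jap x₃) / N := by rwa [one_le_div hN0]
          have h6 : 0 ≤ (m x₁ * jap x₁) * (6 * (m x₂ * jap x₂)) := by positivity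
          have h7 := le_mul_of_one_le_right h6 this
          exact h7.trans (le_mul_of_one_le_right (h6.trans h7) hJ4)
      _ = 72 / N * ((m x₁ * jap x₁) * (m x₂ * jap x₂) * (m x₃ * jap x₃) * (m x₄ * jap x₄)) := by
          ring
      _ ≤ _ := by gcongr; norm_num
  · have e3 := h.eq_one x₃ (by linarith)
    have e4 := h.eq_one x₄ (by linarith)
    have hx2 : N / 3 ≤ |x₂| := by linarith
    have hdiff := h.abs_sub_le hN (x := x₂) (d := x₃ + x₄) (by linarith)
    rw [← h.even (x₂ + (x₃ + x₄)), ← hx1, abs_sub_comm] at hdiff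
    have hd : |x₃ + x₄| ≤ 2 * (jap x₃ * jap x₄) := by
      unfold jap
      nlinarith [mul_nonneg (abs_nonneg x₃) (abs_nonneg x₄), abs_nonneg x₃, abs_nonneg x₄]
    have hj3 := jap_pos x₃
    have hj4 := jap_pos x₄
    rw [e3, e4, mul_one, mul_one, one_mul, one_mul, abs_mul,
      abs_of_nonneg (by positivity : 0 ≤ x₁ ^ 2 * m x₁)]
    have hr : jap x₁ / jap x₂ ^ 2 ≤ 9 / N := by
      have hNj : N ≤ 3 * jap x₂ := by unfold jap; linarith
      rw [div_le_div_iff₀ (by positivity) hN0]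
      nlinarith
    calc x₁ ^ 2 * m x₁ * |m x₂ - m x₁|
        ≤ jap x₁ ^ 2 * m x₁ * (40 * m x₂ / jap x₂ * (2 * (jap x₃ * jap x₄))) := by
          gcongr
          exact hdiff.trans (by gcongr)
      _ = 80 * (jap x₁ / jap x₂ ^ 2)
            * ((m x₁ * jap x₁) * (m x₂ * jap x₂) * jap x₃ * jap x₄) := by
          field_simp
          ring
      _ ≤ 80 * (9 / N) * ((m x₁ * jap x₁) * (m x₂ * jap x₂) * jap x₃ * jap x₄) := by gcongr
      _ = _ := by ring

/-- The symbol `M₄'` gains a factor `N⁻¹` over the product of the weights `m(ξᵢ)⟨ξᵢ⟩`. -/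
theorem symbol_bound (hN : 2 ≤ N) (h : AdmissibleLow N s m) {x₁ x₂ x₃ x₄ : ℝ}
    (hsum : x₁ + x₂ + x₃ + x₄ = 0) :
    |x₁ ^ 2 * m x₁ * (m x₂ * m x₃ * m x₄ - m (x₂ + x₃ + x₄))| ≤
      720 / N * ((m x₁ * jap x₁) * (m x₂ * jap x₂) * (m x₃ * jap x₃) * (m x₄ * jap x₄)) := by
  rw [show x₂ + x₃ + x₄ = -x₁ by linarith, h.even]
  rcases le_total |x₃| |x₂| with h1 | h1 <;> rcases le_total |x₄| |x₃| with h2 | h2 <;>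
    rcases le_total |x₄| |x₂| with h3 | h3
  · exact h.symbol_bound_sorted hN hsum h1 h2
  · exact h.symbol_bound_sorted hN hsum h1 h2
  · convert h.symbol_bound_sorted hN (x₁ := x₁) (x₂ := x₂) (x₃ := x₄) (x₄ := x₃) (by linarith) h3 h2
      using 1 <;> ring_nf
  · convert h.symbol_bound_sorted hN (x₁ := x₁) (x₂ := x₄) (x₃ := x₂) (x₄ := x₃) (by linarith) h3 h1
      using 1 <;> ring_nf
  · convert h.symbol_bound_sorted hN (x₁ := x₁) (x₂ := x₃) (x₃ := x₂) (x₄ := x₄) (by linarith) h1 h3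
      using 1 <;> ring_nf
  · convert h.symbol_bound_sorted hN (x₁ := x₁) (x₂ := x₃) (x₃ := x₄) (x₄ := x₂) (by linarith) h2 h3
      using 1 <;> ring_nf
  · convert h.symbol_bound_sorted hN (x₁ := x₁) (x₂ := x₄) (x₃ := x₃) (x₄ := x₂) (by linarith) h2 h1
      using 1 <;> ring_nf
  · convert h.symbol_bound_sorted hN (x₁ := x₁) (x₂ := x₄) (x₃ := x₃) (x₄ := x₂) (by linarith) h2 h1
      using 1 <;> ring_nf

end AdmissibleLow

/-- The `L²` norm of a nonnegative function. -/
def l2 (g : ℝ → ℝ≥0∞) : ℝ≥0∞ := (∫⁻ x, g x ^ 2) ^ (1 / 2 : ℝ)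

/-- The kernel `1 / ⟨y⟩`. -/
def timeKernel (y : ℝ) : ℝ≥0∞ := ENNReal.ofReal (1 / (1 + |y|))

theorem measurable_timeKernel : Measurable timeKernel := by
  unfold timeKernel
  fun_prop

theorem lintegral_mul_le_sqrt {α : Type*} [MeasurableSpace α] {μ : Measure α} {f g : α → ℝ≥0∞}
    (hf : AEMeasurable f μ) (hg : AEMeasurable g μ) :
    ∫⁻ x, f x * g x ∂μ ≤ (∫⁻ x, f x ^ 2 ∂μ) ^ (1 / 2 : ℝ) * (∫⁻ x, g x ^ 2 ∂μ) ^ (1 / 2 : ℝ) := by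
  simpa using ENNReal.lintegral_mul_le_Lp_mul_Lq μ Real.HolderConjugate.two_two hf hg

theorem l2_comp_sub_left (g : ℝ → ℝ≥0∞) (c : ℝ) : l2 (fun x => g (c - x)) = l2 g := by
  unfold l2
  rw [lintegral_sub_left_eq_self (fun x => g x ^ 2) c]

theorem lintegral_mul_le_l2 {f g : ℝ → ℝ≥0∞} (hf : Measurable f) (hg : Measurable g) :
    ∫⁻ x, f x * g x ≤ l2 f * l2 g :=
  lintegral_mul_le_sqrt hf.aemeasurable hg.aemeasurable

/-- Integrating the `L²` norms of the products `f(η) g(b - η)` over `b`. -/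
theorem lintegral_lintegral_sq_mul {f g : ℝ → ℝ≥0∞} (hf : Measurable f) (hg : Measurable g) :
    ∫⁻ b, ∫⁻ η, (f η * g (b - η)) ^ 2 = (∫⁻ x, f x ^ 2) * ∫⁻ x, g x ^ 2 := by
  rw [lintegral_lintegral_swap (by fun_prop)]
  simp_rw [mul_pow]
  have : ∀ η, ∫⁻ b, f η ^ 2 * g (b - η) ^ 2 = f η ^ 2 * ∫⁻ x, g x ^ 2 := fun η => by
    rw [lintegral_const_mul _ (by fun_prop), lintegral_sub_right_eq_self (fun x => g x ^ 2) η]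
  simp_rw [this]
  rw [lintegral_mul_const _ (by fun_prop)]

theorem lintegral_l2_mul_l2_le {f₁ f₂ g₁ g₂ : ℝ → ℝ≥0∞} (hf₁ : Measurable f₁)
    (hf₂ : Measurable f₂) (hg₁ : Measurable g₁) (hg₂ : Measurable g₂) :
    ∫⁻ b, l2 (fun η => f₁ η * f₂ (b - η)) * l2 (fun η => g₁ η * g₂ (-b - η)) ≤
      (l2 f₁ * l2 f₂) * (l2 g₁ * l2 g₂) := by
  have hm₁ : Measurable fun b => l2 (fun η => f₁ η * f₂ (b - η)) := by
    unfold l2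
    refine Measurable.pow_const (Measurable.lintegral_prod_right' (f := fun p : ℝ × ℝ =>
      (f₁ p.2 * f₂ (p.1 - p.2)) ^ 2) (by fun_prop)) _
  have hm₂ : Measurable fun b => l2 (fun η => g₁ η * g₂ (-b - η)) := by
    unfold l2
    refine Measurable.pow_const (Measurable.lintegral_prod_right' (f := fun p : ℝ × ℝ =>
      (g₁ p.2 * g₂ (-p.1 - p.2)) ^ 2) (by fun_prop)) _
  have hsq : ∀ g : ℝ → ℝ≥0∞, l2 g ^ 2 = ∫⁻ x, g x ^ 2 := fun g => by
    rw [l2, ← ENNReal.rpow_natCast, ← ENNReal.rpow_mul]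
    simp
  refine (lintegral_mul_le_sqrt hm₁.aemeasurable hm₂.aemeasurable).trans (le_of_eq ?_)
  simp_rw [hsq]
  rw [lintegral_lintegral_sq_mul hf₁ hf₂]
  rw [show (∫⁻ b, ∫⁻ η, (g₁ η * g₂ (-b - η)) ^ 2) = ∫⁻ b, ∫⁻ η, (g₁ η * g₂ (b - η)) ^ 2 from
    lintegral_neg_eq_self (fun b => ∫⁻ η, (g₁ η * g₂ (b - η)) ^ 2)]
  rw [lintegral_lintegral_sq_mul hg₁ hg₂]
  unfold l2
  rw [ENNReal.mul_rpow_of_nonneg _ _ (by norm_num), ENNReal.mul_rpow_of_nonneg _ _ (by norm_num)]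

/-- Splitting of the time kernel according to the size of `y` relative to `b²`. -/
theorem timeKernel_le (b y : ℝ) :
    timeKernel y ≤ ENNReal.ofReal (2 * (1 + b ^ 2)⁻¹) +
      ENNReal.ofReal |b| * ENNReal.ofReal ((1 + ‖y‖) ^ (-(3 / 2) : ℝ)) := by
  have hy : 0 < 1 + |y| := by positivity
  have hb : 0 < 1 + b ^ 2 := by positivity
  rw [timeKernel, ← ENNReal.ofReal_mul (abs_nonneg b), ← ENNReal.ofReal_add (by positivity)
    (by positivity)]
  refine ENNReal.ofReal_le_ofReal ?_
  rcases le_or_gt (1 + b ^ 2) (2 * (1 + |y|)) with h | h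
  · have h1 : 1 / (1 + |y|) ≤ 2 * (1 + b ^ 2)⁻¹ := by
      rw [← div_eq_mul_inv, div_le_div_iff₀ hy hb]
      linarith
    have h2 : 0 ≤ |b| * (1 + ‖y‖) ^ (-(3 / 2) : ℝ) := by positivity
    linarith
  · have h0 : 0 ≤ 2 * (1 + b ^ 2)⁻¹ := by positivity
    have hbs : √(1 + |y|) ≤ |b| := by
      refine Real.sqrt_le_iff.2 ⟨abs_nonneg b, ?_⟩
      rw [sq_abs]
      linarith [abs_nonneg y]
    have h3 : 1 / (1 + |y|) = √(1 + |y|) * (1 + |y|) ^ (-(3 / 2) : ℝ) := by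
      rw [Real.sqrt_eq_rpow, ← Real.rpow_add hy, one_div, ← Real.rpow_neg_one]
      norm_num
    rw [h3, norm_eq_abs]
    have : √(1 + |y|) * (1 + |y|) ^ (-(3 / 2) : ℝ) ≤ |b| * (1 + |y|) ^ (-(3 / 2) : ℝ) := by
      gcongr
    linarith

theorem lintegral_comp_mul_add (f : ℝ → ℝ≥0∞) (hf : Measurable f) {b : ℝ} (hb : b ≠ 0) (c : ℝ) :
    ENNReal.ofReal |b| * ∫⁻ a, f (c + b * a) = ∫⁻ y, f y := by
  have h1 : ∫⁻ a, f (c + b * a) = ∫⁻ z, f (c + z) ∂(Measure.map (fun x => b * x) volume) :=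
    (lintegral_map (f := fun z => f (c + z)) (by fun_prop) (by fun_prop)).symm
  rw [h1, Real.map_volume_mul_left hb, lintegral_smul_measure, lintegral_add_left_eq_self, smul_eq_mul,
    ← mul_assoc, ← ENNReal.ofReal_mul (abs_nonneg b), ← abs_mul, mul_inv_cancel₀ hb]
  simp

theorem lintegral_timeKernel_mul_le (F : ℝ → ℝ≥0∞) (hF : Measurable F) (S : ℝ≥0∞)
    (hS : ∀ a, F a ≤ S) (lam b : ℝ) :
    ∫⁻ a, F a * timeKernel (lam + -2 * b * a) ≤ ENNReal.ofReal (2 * (1 + b ^ 2)⁻¹) * (∫⁻ a, F a) +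
      (∫⁻ y : ℝ, ENNReal.ofReal ((1 + ‖y‖) ^ (-(3 / 2) : ℝ))) * S := by
  set h : ℝ → ℝ≥0∞ := fun y => ENNReal.ofReal ((1 + ‖y‖) ^ (-(3 / 2) : ℝ)) with hh
  have hm : Measurable h := by
    simp only [hh]
    fun_prop
  calc ∫⁻ a, F a * timeKernel (lam + -2 * b * a)
      ≤ ∫⁻ a, (ENNReal.ofReal (2 * (1 + b ^ 2)⁻¹) * F a +
          ENNReal.ofReal |b| * h (lam + -2 * b * a) * S) := by
        refine lintegral_mono fun a => ?_
        calc F a * timeKernel (lam + -2 * b * a)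
            ≤ F a * (ENNReal.ofReal (2 * (1 + b ^ 2)⁻¹) +
                ENNReal.ofReal |b| * h (lam + -2 * b * a)) := by
              gcongr
              exact timeKernel_le b _
          _ = ENNReal.ofReal (2 * (1 + b ^ 2)⁻¹) * F a +
                ENNReal.ofReal |b| * h (lam + -2 * b * a) * F a := by ring
          _ ≤ _ := by
              gcongr
              exact hS a
    _ = ENNReal.ofReal (2 * (1 + b ^ 2)⁻¹) * (∫⁻ a, F a) +
          (ENNReal.ofReal |b| * ∫⁻ a, h (lam + -2 * b * a)) * S := by
        rw [lintegral_add_left (by fun_prop), lintegral_const_mul _ hF,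
          lintegral_mul_const _ (by fun_prop), lintegral_const_mul _ (by fun_prop)]
    _ ≤ _ := by
        gcongr
        rcases eq_or_ne b 0 with rfl | hb
        · simp
        · rw [← lintegral_comp_mul_add h hm (b := -2 * b) (by simpa using hb) lam]
          gcongr ENNReal.ofReal ?_ * _
          rw [abs_mul]
          have := abs_nonneg b
          norm_num
          linarith

/-- The quadrilinear estimate behind the `L⁴` Strichartz estimate on unit time intervals, in
variables adapted to the resonance function. -/
theorem quadrilinear_resonance {g₁ g₂ g₃ g₄ : ℝ → ℝ≥0∞} (h₁ : Measurable g₁) (h₂ : Measurable g₂)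
    (h₃ : Measurable g₃) (h₄ : Measurable g₄) (lam : ℝ) :
    ∫⁻ b, ∫⁻ a, (∫⁻ η, g₂ η * g₃ (b - η) * (g₁ (a - η) * g₄ (-b - (a - η)))) *
        timeKernel (lam + -2 * b * a) ≤
      ((∫⁻ b : ℝ, ENNReal.ofReal (2 * (1 + b ^ 2)⁻¹)) +
        ∫⁻ y : ℝ, ENNReal.ofReal ((1 + ‖y‖) ^ (-(3 / 2) : ℝ))) *
      (l2 g₁ * l2 g₂ * l2 g₃ * l2 g₄) := by
  set c := ∫⁻ y : ℝ, ENNReal.ofReal ((1 + ‖y‖) ^ (-(3 / 2) : ℝ)) with hc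
  set A := l2 g₁ * l2 g₂ * l2 g₃ * l2 g₄ with hA
  have hpt : ∀ b : ℝ, ∫⁻ a, (∫⁻ η, g₂ η * g₃ (b - η) * (g₁ (a - η) * g₄ (-b - (a - η)))) *
        timeKernel (lam + -2 * b * a) ≤ ENNReal.ofReal (2 * (1 + b ^ 2)⁻¹) * A +
        c * (l2 (fun η => g₂ η * g₃ (b - η)) * l2 (fun η => g₁ η * g₄ (-b - η))) := by
    intro b
    refine (lintegral_timeKernel_mul_le _ ?_
      (l2 (fun η => g₂ η * g₃ (b - η)) * l2 (fun η => g₁ η * g₄ (-b - η)))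
      (fun a => ?_) lam b).trans ?_
    · exact Measurable.lintegral_prod_right' (f := fun p : ℝ × ℝ =>
        g₂ p.2 * g₃ (b - p.2) * (g₁ (p.1 - p.2) * g₄ (-b - (p.1 - p.2)))) (by fun_prop)
    · refine (lintegral_mul_le_l2 (by fun_prop) (by fun_prop)).trans (le_of_eq ?_)
      rw [l2_comp_sub_left (fun η => g₁ η * g₄ (-b - η)) a]
    · gcongr
      rw [lintegral_lintegral_swap (by fun_prop)]
      have : ∀ η, ∫⁻ a, g₂ η * g₃ (b - η) * (g₁ (a - η) * g₄ (-b - (a - η))) =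
          g₂ η * g₃ (b - η) * ∫⁻ x, g₁ x * g₄ (-b - x) := fun η => by
        rw [lintegral_const_mul _ (by fun_prop),
          lintegral_sub_right_eq_self (fun x => g₁ x * g₄ (-b - x)) η]
      simp_rw [this]
      rw [lintegral_mul_const _ (by fun_prop)]
      have e1 := lintegral_mul_le_l2 h₂ (g := fun η => g₃ (b - η)) (by fun_prop)
      have e2 := lintegral_mul_le_l2 h₁ (g := fun η => g₄ (-b - η)) (by fun_prop)
      rw [l2_comp_sub_left] at e1 e2
      refine (mul_le_mul' e1 e2).trans (le_of_eq ?_)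
      rw [hA]
      ring
  refine (lintegral_mono hpt).trans ?_
  rw [lintegral_add_left (by fun_prop), lintegral_mul_const _ (by fun_prop), add_mul]
  gcongr
  rw [lintegral_const_mul]
  · gcongr
    refine (lintegral_l2_mul_l2_le h₂ h₃ h₁ h₄).trans (le_of_eq ?_)
    rw [hA]
    ring
  · unfold l2
    refine Measurable.mul (Measurable.pow_const (Measurable.lintegral_prod_right'
      (f := fun p : ℝ × ℝ => (g₂ p.2 * g₃ (p.1 - p.2)) ^ 2) (by fun_prop)) _)
      (Measurable.pow_const (Measurable.lintegral_prod_right'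
      (f := fun p : ℝ × ℝ => (g₁ p.2 * g₄ (-p.1 - p.2)) ^ 2) (by fun_prop)) _)

/-- Cyclic reordering of an iterated integral over `ℝ³`. -/
theorem lintegral_rotate {f : ℝ → ℝ → ℝ → ℝ≥0∞}
    (hf : Measurable fun p : ℝ × ℝ × ℝ => f p.1 p.2.1 p.2.2) :
    ∫⁻ x, ∫⁻ y, ∫⁻ z, f x y z = ∫⁻ z, ∫⁻ y, ∫⁻ x, f x y z := by
  have h1 : ∀ x, ∫⁻ y, ∫⁻ z, f x y z = ∫⁻ z, ∫⁻ y, f x y z := fun x =>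
    lintegral_lintegral_swap
      (hf.comp (f := fun p : ℝ × ℝ => (x, p.1, p.2)) (by fun_prop)).aemeasurable
  have h2 : ∫⁻ x, ∫⁻ z, ∫⁻ y, f x y z = ∫⁻ z, ∫⁻ x, ∫⁻ y, f x y z := by
    refine lintegral_lintegral_swap (Measurable.aemeasurable ?_)
    exact Measurable.lintegral_prod_right' (f := fun q : (ℝ × ℝ) × ℝ => f q.1.1 q.2 q.1.2)
      (hf.comp (f := fun q : (ℝ × ℝ) × ℝ => (q.1.1, q.2, q.1.2)) (by fun_prop))
  have h3 : ∀ z, ∫⁻ x, ∫⁻ y, f x y z = ∫⁻ y, ∫⁻ x, f x y z := fun z =>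
    lintegral_lintegral_swap
      (hf.comp (f := fun p : ℝ × ℝ => (p.1, p.2, z)) (by fun_prop)).aemeasurable
  simp_rw [h1, h2, h3]

/-- The constant in `quadrilinear_estimate`. -/
def quadConst : ℝ≥0∞ := (∫⁻ b : ℝ, ENNReal.ofReal (2 * (1 + b ^ 2)⁻¹)) +
  ∫⁻ y : ℝ, ENNReal.ofReal ((1 + ‖y‖) ^ (-(3 / 2) : ℝ))

theorem quadConst_ne_top : quadConst ≠ ∞ :=
  ENNReal.add_ne_top.2 ⟨(integrable_inv_one_add_sq.const_mul 2).lintegral_lt_top.ne,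
    (integrable_one_add_norm (by simp; norm_num)).lintegral_lt_top.ne⟩

theorem quadrilinear_estimate {g₁ g₂ g₃ g₄ : ℝ → ℝ≥0∞} (h₁ : Measurable g₁) (h₂ : Measurable g₂)
    (h₃ : Measurable g₃) (h₄ : Measurable g₄) (lam : ℝ) :
    ∫⁻ x₁, ∫⁻ x₂, ∫⁻ x₃, g₁ x₁ * g₂ x₂ * g₃ x₃ * g₄ (-(x₁ + x₂ + x₃)) *
        timeKernel (lam + (x₁ ^ 2 - x₂ ^ 2 + x₃ ^ 2 - (-(x₁ + x₂ + x₃)) ^ 2)) ≤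
      quadConst * (l2 g₁ * l2 g₂ * l2 g₃ * l2 g₄) := by
  have hk := measurable_timeKernel
  refine le_trans (le_of_eq ?_) (quadrilinear_resonance h₁ h₂ h₃ h₄ lam)
  set f : ℝ → ℝ → ℝ → ℝ≥0∞ := fun x₁ x₂ x₃ => g₁ x₁ * g₂ x₂ * g₃ x₃ * g₄ (-(x₁ + x₂ + x₃)) *
        timeKernel (lam + (x₁ ^ 2 - x₂ ^ 2 + x₃ ^ 2 - (-(x₁ + x₂ + x₃)) ^ 2)) with hfdef
  have hf : Measurable fun p : ℝ × ℝ × ℝ => f p.1 p.2.1 p.2.2 := by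
    simp only [hfdef]
    fun_prop
  calc ∫⁻ x₁, ∫⁻ x₂, ∫⁻ x₃, f x₁ x₂ x₃ = ∫⁻ η, ∫⁻ x₁, ∫⁻ x₃, f x₁ η x₃ :=
        lintegral_lintegral_swap (Measurable.aemeasurable (Measurable.lintegral_prod_right'
          (f := fun q : (ℝ × ℝ) × ℝ => f q.1.1 q.1.2 q.2)
          (hf.comp (f := fun q : (ℝ × ℝ) × ℝ => (q.1.1, q.1.2, q.2)) (by fun_prop))))
    _ = ∫⁻ η, ∫⁻ a, ∫⁻ b, f (a - η) η (b - η) := by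
        refine lintegral_congr fun η => ?_
        rw [← lintegral_sub_right_eq_self (fun x₁ => ∫⁻ x₃, f x₁ η x₃) η]
        refine lintegral_congr fun a => ?_
        rw [← lintegral_sub_right_eq_self (fun x₃ => f (a - η) η x₃) η]
    _ = ∫⁻ b, ∫⁻ a, ∫⁻ η, f (a - η) η (b - η) :=
        lintegral_rotate (f := fun η a b => f (a - η) η (b - η))
          (hf.comp (f := fun p : ℝ × ℝ × ℝ => (p.2.1 - p.1, p.1, p.2.2 - p.1)) (by fun_prop))
    _ = _ := by
        refine lintegral_congr fun b => lintegral_congr fun a => ?_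
        rw [← lintegral_mul_const _ (by fun_prop)]
        refine lintegral_congr fun η => ?_
        simp only [hfdef]
        rw [show lam + ((a - η) ^ 2 - η ^ 2 + (b - η) ^ 2 - (-(a - η + η + (b - η))) ^ 2) =
          lam + -2 * b * a by ring, show -(a - η + η + (b - η)) = -b - (a - η) by ring]
        ring

theorem integrable_fourier_of_contDiff_two {H : ℝ → ℂ} (hH : ContDiff ℝ 2 H)
    (hi : ∀ n : ℕ, n ≤ 2 → Integrable (iteratedDeriv n H)) : Integrable (𝓕 H) := by
  have h0 : Integrable H := by simpa using hi 0 (by norm_num)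
  have hcont : Continuous (𝓕 H) :=
    VectorFourier.fourierIntegral_continuous Real.continuous_fourierChar
      (innerSL ℝ).continuous₂ h0
  have hb : ∀ (f : ℝ → ℂ) (x : ℝ), ‖𝓕 f x‖ ≤ ∫ y, ‖f y‖ := fun f x =>
    VectorFourier.norm_fourierIntegral_le_integral_norm _ _ _ _ _
  have h2 : 𝓕 (iteratedDeriv 2 H) = fun x : ℝ => (2 * π * Complex.I * x) ^ 2 • 𝓕 H x :=
    Real.fourier_iteratedDeriv (N := 2) (n := 2) (by simpa using hH)
      (fun n hn => hi n (by exact_mod_cast hn)) (by norm_num)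
  refine Integrable.mono' (integrable_inv_one_add_sq.const_mul
    ((∫ y, ‖H y‖) + ∫ y, ‖iteratedDeriv 2 H y‖)) hcont.aestronglyMeasurable
    (Filter.Eventually.of_forall fun x => ?_)
  have e0 := hb H x
  have e2 := hb (iteratedDeriv 2 H) x
  rw [h2] at e2
  simp only [norm_smul, norm_pow, norm_mul, Complex.norm_I, Complex.norm_real,
    norm_eq_abs, Complex.norm_ofNat, mul_pow, sq_abs] at e2
  have hpi : 1 ≤ 2 ^ 2 * π ^ 2 := by nlinarith [Real.pi_gt_three]
  have hx : x ^ 2 * ‖𝓕 H x‖ ≤ 2 ^ 2 * π ^ 2 * x ^ 2 * ‖𝓕 H x‖ := by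
    have : 0 ≤ x ^ 2 * ‖𝓕 H x‖ := by positivity
    nlinarith
  rw [← div_eq_mul_inv, le_div_iff₀ (by positivity)]
  linarith

theorem SchwartzMap.integrable_iteratedDeriv_smul {θ : ℝ → ℝ} {C : ℝ}
    (hθ : ContDiff ℝ (⊤ : ℕ∞) θ) (hb : ∀ n ≤ 2, ∀ x, ‖iteratedDeriv n θ x‖ ≤ C)
    (φ : SchwartzMap ℝ ℂ) {n : ℕ} (hn : n ≤ 2) :
    Integrable (iteratedDeriv n (fun x => θ x • φ x)) := by
  have hφ := φ.smooth (⊤ : ℕ∞)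
  have hcd : ContDiff ℝ (⊤ : ℕ∞) (fun x => θ x • φ x) := hθ.smul hφ
  have hdom : Integrable (fun x => ∑ i ∈ Finset.range (n + 1),
      (n.choose i : ℝ) * C * ‖iteratedFDeriv ℝ (n - i) φ x‖) := by
    refine integrable_finsetSum _ fun i _ => Integrable.const_mul ?_ _
    simpa using φ.integrable_pow_mul_iteratedFDeriv volume 0 (n - i)
  refine hdom.mono' (hcd.continuous_iteratedDeriv n (by exact_mod_cast le_top)).aestronglyMeasurable
    (Filter.Eventually.of_forall fun x => ?_)
  rw [← norm_iteratedFDeriv_eq_norm_iteratedDeriv]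
  refine (norm_iteratedFDeriv_smul_le hθ hφ x (n := n) (by exact_mod_cast le_top)).trans ?_
  refine Finset.sum_le_sum fun i hi => ?_
  have := hb i (by have := Finset.mem_range.1 hi; omega) x
  rw [← norm_iteratedFDeriv_eq_norm_iteratedDeriv] at this
  gcongr

theorem ft_eq_fourier (f : ℝ → ℂ) (ξ : ℝ) : ft f ξ = 𝓕 f (ξ / (2 * π)) := by
  rw [Real.fourier_eq', ft]
  refine integral_congr_ae (Filter.Eventually.of_forall fun x => ?_)
  simp only [smul_eq_mul]
  congr 2
  simp only [RCLike.inner_apply, conj_trivial]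
  have : (π : ℂ) ≠ 0 := by exact_mod_cast Real.pi_ne_zero
  push_cast
  field_simp

/-- A Fourier multiplier with a `C²`-bounded symbol acts on Schwartz functions by multiplication
on the Fourier side. -/
theorem ft_mult {θ : ℝ → ℝ} {C : ℝ} (hθ : ContDiff ℝ (⊤ : ℕ∞) θ)
    (hb : ∀ n ≤ 2, ∀ x, ‖iteratedDeriv n θ x‖ ≤ C) (f : SchwartzMap ℝ ℂ) (ξ : ℝ) :
    ft (mult θ f) ξ = θ ξ * ft f ξ := by
  have hpi : (0 : ℝ) < 2 * π := by positivity
  have hC : 0 ≤ C := (norm_nonneg _).trans (hb 0 (by norm_num) 0)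
  set θ' : ℝ → ℝ := fun x => θ (2 * π * x) with hθ'
  have hθ'c : ContDiff ℝ (⊤ : ℕ∞) θ' := hθ.comp (by fun_prop)
  have hb' : ∀ n ≤ 2, ∀ x, ‖iteratedDeriv n θ' x‖ ≤ (2 * π) ^ 2 * C := by
    intro n hn x
    rw [hθ', iteratedDeriv_comp_const_mul (hθ.of_le (by exact_mod_cast le_top))]
    simp only [norm_mul, norm_pow]
    rw [← norm_mul, norm_of_nonneg hpi.le]
    have h1 : 1 ≤ 2 * π := by linarith [Real.pi_gt_three]
    have h2 := hb n hn (2 * π * x)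
    gcongr
  set H : ℝ → ℂ := fun x => θ' x • (𝓕 f : SchwartzMap ℝ ℂ) x with hH
  have hHi := fun n (hn : n ≤ 2) =>
    SchwartzMap.integrable_iteratedDeriv_smul hθ'c hb' (𝓕 f : SchwartzMap ℝ ℂ) hn
  have hHc : ContDiff ℝ (⊤ : ℕ∞) H := hθ'c.smul ((𝓕 f : SchwartzMap ℝ ℂ).smooth (⊤ : ℕ∞))
  have hF : Integrable (𝓕 H) :=
    integrable_fourier_of_contDiff_two (contDiff_infty.1 hHc 2) hHi
  have hH0 : Integrable H := by
    have := hHi 0 (by norm_num)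
    rwa [iteratedDeriv_zero] at this
  have hinv : 𝓕 (𝓕⁻ H) = H :=
    hHc.continuous.fourier_fourierInv_eq hH0 hF
  have hmult : mult θ f = 𝓕⁻ H := by
    ext x
    rw [mult, Real.fourierInv_eq']
    have hsub := Measure.integral_comp_mul_left
      (fun η : ℝ => Complex.exp (Complex.I * x * η) * (θ η : ℂ) * ft f η) (2 * π)
    rw [abs_of_pos (inv_pos.2 hpi)] at hsub
    rw [← hsub]
    refine integral_congr_ae (Filter.Eventually.of_forall fun η => ?_)
    simp only [hH, hθ', smul_eq_mul, Complex.real_smul]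
    rw [ft_eq_fourier, mul_div_cancel_left₀ _ hpi.ne', SchwartzMap.fourier_coe, mul_assoc]
    congr 2
    simp only [RCLike.inner_apply, conj_trivial]
    push_cast
    ring
  rw [hmult, ft_eq_fourier, hinv, ft_eq_fourier]
  simp only [hH, hθ', SchwartzMap.fourier_coe, Complex.real_smul]
  rw [mul_div_cancel₀ _ hpi.ne']

theorem exists_schwartz_decay (g : SchwartzMap (ℝ × ℝ) ℂ) (k : ℕ) :
    ∃ C : ℝ, 0 ≤ C ∧ ∀ x t : ℝ, jap x ^ k * jap t ^ k * ‖g (x, t)‖ ≤ C := by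
  have hg := fun p => SchwartzMap.one_add_le_sup_seminorm_apply (𝕜 := ℝ) (m := (k + k, 0))
    (k := k + k) (n := 0) le_rfl le_rfl g p
  refine ⟨_, le_trans (by positivity) (hg 0), fun x t => ?_⟩
  refine le_trans ?_ (hg (x, t))
  rw [norm_iteratedFDeriv_zero, pow_add]
  have h1 : jap x ≤ 1 + ‖(x, t)‖ := by
    simp [jap]
  have h2 : jap t ≤ 1 + ‖(x, t)‖ := by
    simp [jap]
  have := jap_pos x
  have := jap_pos t
  gcongr

theorem continuous_jap : Continuous jap := by
  unfold jap
  fun_prop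

theorem integrable_jap_inv_sq : Integrable (fun x => (jap x ^ 2)⁻¹) := by
  have h := integrable_one_add_norm (E := ℝ) (μ := volume) (r := 2) (by simp)
  refine h.congr (Filter.Eventually.of_forall fun x => ?_)
  simp only [jap, norm_eq_abs]
  rw [Real.rpow_neg (by positivity)]
  norm_cast

theorem norm_exp_I_mul (a : ℝ) : ‖Complex.exp (Complex.I * a)‖ = 1 := by
  rw [mul_comm]; exact Complex.norm_exp_ofReal_mul_I a

theorem stft_eq_integral_ft (u : ℝ → ℝ → ℂ) (ξ τ : ℝ) :
    stft u ξ τ = ∫ t : ℝ, Complex.exp (-Complex.I * t * τ) * ft (fun x => u x t) ξ := by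
  unfold stft ft
  refine integral_congr_ae (Filter.Eventually.of_forall fun t => ?_)
  simp only
  rw [← integral_const_mul]
  refine integral_congr_ae (Filter.Eventually.of_forall fun x => ?_)
  simp only
  rw [← mul_assoc, ← Complex.exp_add]
  ring_nf

theorem norm_exp_neg_I_mul_mul (a b : ℝ) : ‖Complex.exp (-Complex.I * a * b)‖ = 1 := by
  rw [show -Complex.I * a * b = Complex.I * ((-(a * b) : ℝ) : ℂ) by push_cast; ring]
  exact norm_exp_I_mul _

/-- The spacetime Fourier transform of a Schwartz function is a rescaled Schwartz function. -/
theorem exists_stft_eq (g : SchwartzMap (ℝ × ℝ) ℂ) :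
    ∃ G : SchwartzMap (ℝ × ℝ) ℂ, ∀ ξ τ : ℝ,
      stft (fun x t => g (x, t)) ξ τ = G (ξ / (2 * π), τ / (2 * π)) := by
  set e := WithLp.prodContinuousLinearEquiv 2 ℝ ℝ ℝ with he
  set g' : SchwartzMap (WithLp 2 (ℝ × ℝ)) ℂ :=
    SchwartzMap.compCLMOfContinuousLinearEquiv ℂ e g with hg'
  refine ⟨SchwartzMap.compCLMOfContinuousLinearEquiv ℂ e.symm (𝓕 g'), fun ξ τ => ?_⟩
  have hgint : Integrable (fun p : ℝ × ℝ =>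
      Complex.exp (-Complex.I * (p.1 * ξ + p.2 * τ)) * g p) := by
    refine g.integrable.bdd_mul (c := 1) (by fun_prop) (Filter.Eventually.of_forall fun p => ?_)
    rw [show -Complex.I * (p.1 * ξ + p.2 * τ) = Complex.I * ((-(p.1 * ξ + p.2 * τ) : ℝ) : ℂ) by
      push_cast; ring]
    exact (norm_exp_I_mul _).le
  have h1 : stft (fun x t => g (x, t)) ξ τ =
      ∫ p : ℝ × ℝ, Complex.exp (-Complex.I * (p.1 * ξ + p.2 * τ)) * g p :=
    (integral_prod_symm _ hgint).symm
  rw [h1]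
  simp only [SchwartzMap.compCLMOfContinuousLinearEquiv_apply, Function.comp_apply]
  rw [SchwartzMap.fourier_coe, Real.fourier_eq',
    ← (WithLp.volume_preserving_ofLp ℝ ℝ).integral_comp
      (MeasurableEquiv.toLp 2 (ℝ × ℝ)).symm.measurableEmbedding]
  refine integral_congr_ae (Filter.Eventually.of_forall fun v => ?_)
  have hpi : (π : ℂ) ≠ 0 := by exact_mod_cast Real.pi_ne_zero
  simp only [smul_eq_mul, hg', SchwartzMap.compCLMOfContinuousLinearEquiv_apply,
    Function.comp_apply]
  congr 2
  rw [WithLp.prod_inner_apply]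
  simp [he]
  field_simp

theorem exists_stft_decay (g : SchwartzMap (ℝ × ℝ) ℂ) (k : ℕ) :
    Continuous (fun p : ℝ × ℝ => stft (fun x t => g (x, t)) p.1 p.2) ∧
    ∃ C : ℝ, 0 ≤ C ∧ ∀ ξ τ : ℝ,
      jap ξ ^ k * jap τ ^ k * ‖stft (fun x t => g (x, t)) ξ τ‖ ≤ C := by
  obtain ⟨G, hG⟩ := exists_stft_eq g
  obtain ⟨C, hC0, hC⟩ := exists_schwartz_decay G k
  have hpi : (0 : ℝ) < 2 * π := by positivity
  refine ⟨?_, (2 * π) ^ k * (2 * π) ^ k * C, by positivity, fun ξ τ => ?_⟩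
  · simp_rw [hG]
    fun_prop
  · have hj : ∀ x : ℝ, jap x ≤ 2 * π * jap (x / (2 * π)) := fun x => by
      rw [jap, jap, abs_div, abs_of_pos hpi, mul_add, mul_div_cancel₀ _ hpi.ne']
      linarith [Real.pi_gt_three]
    have h := hC (ξ / (2 * π)) (τ / (2 * π))
    have h1 := hj ξ
    have h2 := hj τ
    have := jap_pos ξ
    have := jap_pos τ
    have := jap_pos (ξ / (2 * π))
    rw [hG]
    calc jap ξ ^ k * jap τ ^ k * ‖G (ξ / (2 * π), τ / (2 * π))‖
        ≤ (2 * π * jap (ξ / (2 * π))) ^ k * (2 * π * jap (τ / (2 * π))) ^ k *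
            ‖G (ξ / (2 * π), τ / (2 * π))‖ := by gcongr
      _ = (2 * π) ^ k * (2 * π) ^ k * (jap (ξ / (2 * π)) ^ k * jap (τ / (2 * π)) ^ k *
            ‖G (ξ / (2 * π), τ / (2 * π))‖) := by ring
      _ ≤ _ := by gcongr

/-- The time slices of a Schwartz function on spacetime. -/
theorem exists_schwartz_slice (g : SchwartzMap (ℝ × ℝ) ℂ) (t : ℝ) :
    ∃ f : SchwartzMap ℝ ℂ, ⇑f = fun x => g (x, t) := by
  have h1 : Function.HasTemperateGrowth (fun x : ℝ => (x, t)) := by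
    have : (fun x : ℝ => (x, t)) =
        fun x => (ContinuousLinearMap.inl ℝ ℝ ℝ) x + ((0, t) : ℝ × ℝ) := by
      ext x <;> simp
    rw [this]
    fun_prop
  have h2 : AntilipschitzWith 1 (fun x : ℝ => (x, t)) :=
    AntilipschitzWith.of_le_mul_dist fun x y => by simp [Prod.dist_eq]
  exact ⟨SchwartzMap.compCLMOfAntilipschitz ℝ h1 h2 g, rfl⟩

theorem continuous_integrable_ft_slice (g : SchwartzMap (ℝ × ℝ) ℂ) (ξ : ℝ) :
    Continuous (fun t => ft (fun x => g (x, t)) ξ) ∧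
    Integrable (fun t => ft (fun x => g (x, t)) ξ) := by
  obtain ⟨C, hC0, hC⟩ := exists_schwartz_decay g 2
  have hb : ∀ x t, ‖g (x, t)‖ ≤ (jap t ^ 2)⁻¹ * C * (jap x ^ 2)⁻¹ := fun x t => by
    have := jap_pos x
    have := jap_pos t
    have h := hC x t
    rw [← div_eq_mul_inv, le_div_iff₀ (by positivity), inv_mul_eq_div, le_div_iff₀ (by positivity)]
    linarith
  have hnorm : ∀ x t : ℝ, ‖Complex.exp (-Complex.I * x * ξ) * g (x, t)‖ = ‖g (x, t)‖ := fun x t => by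
    rw [norm_mul, norm_exp_neg_I_mul_mul, one_mul]
  have hcont : Continuous (fun t => ft (fun x => g (x, t)) ξ) := by
    unfold ft
    refine continuous_of_dominated (bound := fun x => C * (jap x ^ 2)⁻¹)
      (fun t => by fun_prop) (fun t => Filter.Eventually.of_forall fun x => ?_)
      (integrable_jap_inv_sq.const_mul C) (Filter.Eventually.of_forall fun x => by fun_prop)
    rw [hnorm]
    refine (hb x t).trans ?_
    have h1 : (jap t ^ 2)⁻¹ ≤ 1 := inv_le_one_of_one_le₀ (one_le_pow₀ (one_le_jap t))
    have := jap_pos x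
    gcongr
    exact mul_le_of_le_one_left hC0 h1
  refine ⟨hcont, ((integrable_jap_inv_sq.mul_const C).mul_const
    (∫ x, (jap x ^ 2)⁻¹)).mono' hcont.aestronglyMeasurable
    (Filter.Eventually.of_forall fun t => ?_)⟩
  rw [← integral_const_mul]
  refine norm_integral_le_of_norm_le (integrable_jap_inv_sq.const_mul _)
    (Filter.Eventually.of_forall fun x => ?_)
  rw [hnorm]
  exact hb x t

/-- Fourier inversion in the time variable. -/
theorem ft_eq_integral_stft (g : SchwartzMap (ℝ × ℝ) ℂ) (ξ t : ℝ) :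
    ft (fun x => g (x, t)) ξ =
      (2 * π)⁻¹ • ∫ τ : ℝ, Complex.exp (Complex.I * t * τ) * stft (fun x t => g (x, t)) ξ τ := by
  have hpi : (0 : ℝ) < 2 * π := by positivity
  obtain ⟨hcont, hgint⟩ := continuous_integrable_ft_slice g ξ
  obtain ⟨hsc, C, hC0, hC⟩ := exists_stft_decay g 2
  set w : ℝ → ℂ := fun t => ft (fun x => g (x, t)) ξ with hw
  have hst : ∀ τ, stft (fun x t => g (x, t)) ξ (2 * π * τ) = 𝓕 w τ := fun τ => by
    rw [stft_eq_integral_ft]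
    have := ft_eq_fourier w (2 * π * τ)
    rw [mul_div_cancel_left₀ _ hpi.ne'] at this
    exact this
  have hsi : Integrable (fun τ => stft (fun x t => g (x, t)) ξ τ) := by
    refine (integrable_jap_inv_sq.const_mul C).mono'
      (hsc.comp (f := fun τ => (ξ, τ)) (by fun_prop)).aestronglyMeasurable
      (Filter.Eventually.of_forall fun τ => ?_)
    have := jap_pos τ
    rw [← div_eq_mul_inv, le_div_iff₀ (by positivity), mul_comm]
    refine le_trans ?_ (hC ξ τ)
    gcongr
    exact le_mul_of_one_le_left (by positivity) (one_le_pow₀ (one_le_jap ξ))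
  have hFi : Integrable (𝓕 w) := by
    have : 𝓕 w = fun τ => stft (fun x t => g (x, t)) ξ (2 * π * τ) := funext fun τ => (hst τ).symm
    rw [this]
    exact hsi.comp_mul_left' hpi.ne'
  have hinv := congrFun (hcont.fourierInv_fourier_eq hgint hFi) t
  rw [Real.fourierInv_eq'] at hinv
  have hsub := Measure.integral_comp_mul_left
    (fun τ : ℝ => Complex.exp (Complex.I * t * τ) * stft (fun x t => g (x, t)) ξ τ) (2 * π)
  rw [abs_of_pos (inv_pos.2 hpi)] at hsub
  rw [← hsub]
  refine hinv.symm.trans ?_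
  refine integral_congr_ae (Filter.Eventually.of_forall fun τ => ?_)
  simp only [smul_eq_mul, hst]
  congr 2
  simp only [RCLike.inner_apply, conj_trivial]
  push_cast
  ring

theorem ft_cj (f : ℝ → ℂ) (ξ : ℝ) : ft (cj f) ξ = (starRingEnd ℂ) (ft f (-ξ)) := by
  unfold ft cj
  rw [← integral_conj]
  refine integral_congr_ae (Filter.Eventually.of_forall fun x => ?_)
  simp only [map_mul, ← Complex.exp_conj, Complex.conj_I, Complex.conj_ofReal, map_neg]
  congr 2
  push_cast
  ring

theorem norm_integral_exp_le {δ : ℝ} (t₀ μ : ℝ) (hδ : 0 < δ) (hδ1 : δ ≤ 1) :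
    ‖∫ t in t₀..(t₀ + δ), Complex.exp (Complex.I * t * μ)‖ ≤ 3 * (1 / (1 + |μ|)) := by
  have hnorm : ∀ t : ℝ, ‖Complex.exp (Complex.I * t * μ)‖ = 1 := fun t => by
    rw [mul_assoc, ← Complex.ofReal_mul]; exact norm_exp_I_mul _
  rw [mul_one_div, le_div_iff₀ (by positivity)]
  rcases le_or_gt |μ| 2 with h | h
  · have h1 : ‖∫ t in t₀..(t₀ + δ), Complex.exp (Complex.I * t * μ)‖ ≤ 1 * |t₀ + δ - t₀| :=
      intervalIntegral.norm_integral_le_of_norm_le_const fun t _ => (hnorm t).le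
    rw [add_sub_cancel_left, abs_of_pos hδ, one_mul] at h1
    have := abs_nonneg μ
    nlinarith
  · have hμ : μ ≠ 0 := by rintro rfl; norm_num at h
    have hc : Complex.I * μ ≠ 0 := mul_ne_zero Complex.I_ne_zero (by exact_mod_cast hμ)
    have h1 : ∀ t : ℝ, Complex.I * t * μ = (Complex.I * μ) * t := fun t => by ring
    simp_rw [h1] at hnorm ⊢
    rw [integral_exp_mul_complex hc, norm_div, norm_mul, Complex.norm_I, one_mul,
      Complex.norm_real, norm_eq_abs]
    have h2 := norm_sub_le (Complex.exp (Complex.I * μ * (t₀ + δ : ℝ)))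
      (Complex.exp (Complex.I * μ * t₀))
    rw [hnorm, hnorm] at h2
    rw [div_mul_eq_mul_div, div_le_iff₀ (by linarith)]
    nlinarith

theorem enorm_integral_exp_le {δ : ℝ} (t₀ μ : ℝ) (hδ : 0 < δ) (hδ1 : δ ≤ 1) :
    ‖∫ t in t₀..(t₀ + δ), Complex.exp (Complex.I * t * μ)‖ₑ ≤ 3 * timeKernel μ := by
  rw [← ofReal_norm, timeKernel, show (3 : ℝ≥0∞) = ENNReal.ofReal 3 by simp,
    ← ENNReal.ofReal_mul (by norm_num)]
  exact ENNReal.ofReal_le_ofReal (norm_integral_exp_le t₀ μ hδ hδ1)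

/-- Continuity and decay of a function of frequency and time frequency. -/
structure SpectralDecay (V : ℝ → ℝ → ℂ) : Prop where
  cont : Continuous fun p : ℝ × ℝ => V p.1 p.2
  decay : ∃ C : ℝ, 0 ≤ C ∧ ∀ x τ : ℝ, ‖V x τ‖ ≤ C * ((jap x ^ 2)⁻¹ * (jap x ^ 2)⁻¹) * (jap τ ^ 2)⁻¹

section Fubini

variable {m : ℝ × ℝ × ℝ → ℝ} {V₁ V₂ V₃ V₄ : ℝ → ℝ → ℂ}

/-- The four-linear density on the frequency hyperplane. -/
def density (m : ℝ × ℝ × ℝ → ℝ) (V₁ V₂ V₃ V₄ : ℝ → ℝ → ℂ)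
    (p : (ℝ × ℝ × ℝ) × (ℝ × ℝ × ℝ × ℝ)) : ℂ :=
  (m p.1 : ℂ) * (V₁ p.1.1 p.2.1 * (V₂ p.1.2.1 p.2.2.1 * (V₃ p.1.2.2 p.2.2.2.1 *
    V₄ (-(p.1.1 + p.1.2.1 + p.1.2.2)) p.2.2.2.2)))

theorem continuous_density (hm : Continuous m) (h₁ : SpectralDecay V₁) (h₂ : SpectralDecay V₂)
    (h₃ : SpectralDecay V₃) (h₄ : SpectralDecay V₄) : Continuous (density m V₁ V₂ V₃ V₄) := by
  unfold density
  have c₁ := h₁.cont.comp (f := fun p : (ℝ × ℝ × ℝ) × (ℝ × ℝ × ℝ × ℝ) => (p.1.1, p.2.1))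
    (by fun_prop)
  have c₂ := h₂.cont.comp (f := fun p : (ℝ × ℝ × ℝ) × (ℝ × ℝ × ℝ × ℝ) => (p.1.2.1, p.2.2.1))
    (by fun_prop)
  have c₃ := h₃.cont.comp (f := fun p : (ℝ × ℝ × ℝ) × (ℝ × ℝ × ℝ × ℝ) => (p.1.2.2, p.2.2.2.1))
    (by fun_prop)
  have c₄ := h₄.cont.comp (f := fun p : (ℝ × ℝ × ℝ) × (ℝ × ℝ × ℝ × ℝ) =>
    (-(p.1.1 + p.1.2.1 + p.1.2.2), p.2.2.2.2)) (by fun_prop)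
  exact (by fun_prop : Continuous fun p : (ℝ × ℝ × ℝ) × (ℝ × ℝ × ℝ × ℝ) => (m p.1 : ℂ)).mul
    (c₁.mul (c₂.mul (c₃.mul c₄)))

theorem integrable_density (hm : Continuous m) {K : ℝ} (hK : ∀ p, |m p| ≤ K * jap p.1 ^ 2)
    (h₁ : SpectralDecay V₁) (h₂ : SpectralDecay V₂)
    (h₃ : SpectralDecay V₃) (h₄ : SpectralDecay V₄) : Integrable (density m V₁ V₂ V₃ V₄) := by
  have hc := continuous_density hm h₁ h₂ h₃ h₄
  obtain ⟨C₁, hC₁, b₁⟩ := h₁.decay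
  obtain ⟨C₂, hC₂, b₂⟩ := h₂.decay
  obtain ⟨C₃, hC₃, b₃⟩ := h₃.decay
  obtain ⟨C₄, hC₄, b₄⟩ := h₄.decay
  set j : ℝ → ℝ := fun x => (jap x ^ 2)⁻¹ with hj
  have hj0 : ∀ x, 0 ≤ j x := fun x => by
    have := jap_pos x
    simp only [hj]; positivity
  have hj1 : ∀ x, j x ≤ 1 := fun x => inv_le_one_of_one_le₀ (one_le_pow₀ (one_le_jap x))
  have hji : Integrable j := integrable_jap_inv_sq
  have hdom : Integrable (fun p : (ℝ × ℝ × ℝ) × (ℝ × ℝ × ℝ × ℝ) =>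
      (K * C₁ * C₂ * C₃ * C₄) * ((j p.1.1 * (j p.1.2.1 * j p.1.2.2)) *
        (j p.2.1 * (j p.2.2.1 * (j p.2.2.2.1 * j p.2.2.2.2))))) :=
    ((hji.mul_prod (hji.mul_prod hji)).mul_prod
      (hji.mul_prod (hji.mul_prod (hji.mul_prod hji)))).const_mul _
  refine hdom.mono' hc.aestronglyMeasurable (Filter.Eventually.of_forall fun p => ?_)
  obtain ⟨⟨x₁, x₂, x₃⟩, t₁, t₂, t₃, t₄⟩ := p
  have e₂ : ‖V₂ x₂ t₂‖ ≤ C₂ * j x₂ * j t₂ := (b₂ x₂ t₂).trans (by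
    have := hj0 x₂; have := hj0 t₂
    gcongr
    exact mul_le_of_le_one_left (hj0 x₂) (hj1 x₂))
  have e₃ : ‖V₃ x₃ t₃‖ ≤ C₃ * j x₃ * j t₃ := (b₃ x₃ t₃).trans (by
    have := hj0 x₃; have := hj0 t₃
    gcongr
    exact mul_le_of_le_one_left (hj0 x₃) (hj1 x₃))
  have e₄ : ‖V₄ (-(x₁ + x₂ + x₃)) t₄‖ ≤ C₄ * j t₄ := (b₄ _ t₄).trans (by
    have := hj0 t₄
    gcongr
    exact mul_le_of_le_one_right hC₄ (mul_le_one₀ (hj1 _) (hj0 _) (hj1 _)))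
  have e₁ : |m (x₁, x₂, x₃)| * ‖V₁ x₁ t₁‖ ≤ K * C₁ * j x₁ * j t₁ := by
    have hK' := hK (x₁, x₂, x₃)
    simp only at hK'
    refine (mul_le_mul hK' (b₁ x₁ t₁) (norm_nonneg _) ((abs_nonneg _).trans hK')).trans
      (le_of_eq ?_)
    have : jap x₁ ^ 2 * j x₁ = 1 := mul_inv_cancel₀ (pow_ne_zero 2 (jap_pos x₁).ne')
    change K * jap x₁ ^ 2 * (C₁ * (j x₁ * j x₁) * j t₁) = _
    linear_combination K * C₁ * j x₁ * j t₁ * this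
  have p₁ := (mul_nonneg (abs_nonneg (m (x₁, x₂, x₃))) (norm_nonneg (V₁ x₁ t₁))).trans e₁
  have := hj0 x₂; have := hj0 t₂; have := hj0 x₃; have := hj0 t₃
  simp only [density, norm_mul, Complex.norm_real, norm_eq_abs]
  rw [← mul_assoc]
  calc |m (x₁, x₂, x₃)| * ‖V₁ x₁ t₁‖ *
        (‖V₂ x₂ t₂‖ * (‖V₃ x₃ t₃‖ * ‖V₄ (-(x₁ + x₂ + x₃)) t₄‖))
      ≤ (K * C₁ * j x₁ * j t₁) * ((C₂ * j x₂ * j t₂) * ((C₃ * j x₃ * j t₃) * (C₄ * j t₄))) := by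
        gcongr
    _ = _ := by ring

/-- The phase `e^{it(τ₁+τ₂+τ₃+τ₄)}`. -/
def phase (t : ℝ) (q : ℝ × ℝ × ℝ × ℝ) : ℂ :=
  Complex.exp (Complex.I * t * ((q.1 + q.2.1 + q.2.2.1 + q.2.2.2 : ℝ) : ℂ))

theorem norm_phase (t : ℝ) (q : ℝ × ℝ × ℝ × ℝ) : ‖phase t q‖ = 1 := by
  rw [phase, mul_assoc, ← Complex.ofReal_mul]; exact norm_exp_I_mul _

theorem continuous_phase : Continuous fun p : ℝ × (ℝ × ℝ × ℝ × ℝ) => phase p.1 p.2 := by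
  unfold phase
  fun_prop

theorem integral_phase_mul_density (t : ℝ) (x : ℝ × ℝ × ℝ) :
    ∫ q, phase t q * density m V₁ V₂ V₃ V₄ (x, q) =
      (m x : ℂ) * ((∫ τ : ℝ, Complex.exp (Complex.I * t * τ) * V₁ x.1 τ) *
        ((∫ τ : ℝ, Complex.exp (Complex.I * t * τ) * V₂ x.2.1 τ) *
        ((∫ τ : ℝ, Complex.exp (Complex.I * t * τ) * V₃ x.2.2 τ) *
        (∫ τ : ℝ, Complex.exp (Complex.I * t * τ) * V₄ (-(x.1 + x.2.1 + x.2.2)) τ)))) := by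
  rw [← integral_prod_mul, ← integral_prod_mul, ← integral_prod_mul, ← integral_const_mul]
  refine integral_congr_ae (Filter.Eventually.of_forall fun q => ?_)
  have : phase t q = Complex.exp (Complex.I * t * q.1) * (Complex.exp (Complex.I * t * q.2.1) *
      (Complex.exp (Complex.I * t * q.2.2.1) * Complex.exp (Complex.I * t * q.2.2.2))) := by
    rw [phase, ← Complex.exp_add, ← Complex.exp_add, ← Complex.exp_add]
    push_cast
    ring_nf
  simp only [this, density]
  ring

theorem Lam4_eq_integral_density {M : ℝ → ℝ → ℝ → ℝ → ℝ}
    (hMm : ∀ x₁ x₂ x₃, M x₁ x₂ x₃ (-(x₁ + x₂ + x₃)) = m (x₁, x₂, x₃))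
    (hi : Integrable (density m V₁ V₂ V₃ V₄)) (t : ℝ) {f₁ f₂ f₃ f₄ : ℝ → ℂ}
    (e₁ : ∀ ξ, ft f₁ ξ = (2 * π)⁻¹ • ∫ τ : ℝ, Complex.exp (Complex.I * t * τ) * V₁ ξ τ)
    (e₂ : ∀ ξ, ft f₂ ξ = (2 * π)⁻¹ • ∫ τ : ℝ, Complex.exp (Complex.I * t * τ) * V₂ ξ τ)
    (e₃ : ∀ ξ, ft f₃ ξ = (2 * π)⁻¹ • ∫ τ : ℝ, Complex.exp (Complex.I * t * τ) * V₃ ξ τ)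
    (e₄ : ∀ ξ, ft f₄ ξ = (2 * π)⁻¹ • ∫ τ : ℝ, Complex.exp (Complex.I * t * τ) * V₄ ξ τ) :
    Lam4 M f₁ f₂ f₃ f₄ =
      (((2 * π)⁻¹ ^ 4 : ℝ) : ℂ) * ∫ p, phase t p.2 * density m V₁ V₂ V₃ V₄ p := by
  have hi' : Integrable (fun p : (ℝ × ℝ × ℝ) × (ℝ × ℝ × ℝ × ℝ) =>
      phase t p.2 * density m V₁ V₂ V₃ V₄ p) :=
    hi.bdd_mul (c := 1) (continuous_phase.comp (f := fun p : (ℝ × ℝ × ℝ) × (ℝ × ℝ × ℝ × ℝ) =>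
      (t, p.2)) (by fun_prop)).aestronglyMeasurable
      (Filter.Eventually.of_forall fun p => (norm_phase t p.2).le)
  set J : ℝ × ℝ × ℝ → ℂ := fun x => ∫ q, phase t q * density m V₁ V₂ V₃ V₄ (x, q) with hJ
  have hJi : Integrable J := hi'.integral_prod_left
  have h1 : ∫ p, phase t p.2 * density m V₁ V₂ V₃ V₄ p = ∫ x, J x := integral_prod _ hi'
  have h2 : ∫ x, J x = ∫ x₁, ∫ x₂, ∫ x₃, J (x₁, x₂, x₃) := by
    refine (integral_prod _ hJi).trans (integral_congr_ae ?_)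
    filter_upwards [hJi.prod_right_ae] with x₁ hx₁
    exact integral_prod _ hx₁
  rw [h1, h2, Lam4, ← integral_const_mul]
  refine integral_congr_ae (Filter.Eventually.of_forall fun x₁ => ?_)
  simp only
  rw [← integral_const_mul]
  refine integral_congr_ae (Filter.Eventually.of_forall fun x₂ => ?_)
  simp only
  rw [← integral_const_mul]
  refine integral_congr_ae (Filter.Eventually.of_forall fun x₃ => ?_)
  simp only [hJ, integral_phase_mul_density, e₁, e₂, e₃, e₄, hMm, Complex.real_smul]
  push_cast
  ring

theorem enorm_integral_phase_density_le (hi : Integrable (density m V₁ V₂ V₃ V₄)) {δ : ℝ} (t₀ : ℝ)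
    (hδ : 0 < δ) (hδ1 : δ ≤ 1) :
    ‖∫ t in t₀..(t₀ + δ), ∫ p, phase t p.2 * density m V₁ V₂ V₃ V₄ p‖ₑ ≤
      ∫⁻ p, ‖density m V₁ V₂ V₃ V₄ p‖ₑ *
        (3 * timeKernel (p.2.1 + p.2.2.1 + p.2.2.2.1 + p.2.2.2.2)) := by
  have hle : t₀ ≤ t₀ + δ := by linarith
  have hprod : Integrable (Function.uncurry fun (t : ℝ) (p : (ℝ × ℝ × ℝ) × (ℝ × ℝ × ℝ × ℝ)) =>
      phase t p.2 * density m V₁ V₂ V₃ V₄ p)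
      ((volume.restrict (Set.Ioc t₀ (t₀ + δ))).prod volume) := by
    refine (hi.comp_snd (volume.restrict (Set.Ioc t₀ (t₀ + δ)))).bdd_mul (c := 1)
      (continuous_phase.comp (f := fun p : ℝ × ((ℝ × ℝ × ℝ) × (ℝ × ℝ × ℝ × ℝ)) => (p.1, p.2.2))
        (by fun_prop)).aestronglyMeasurable
      (Filter.Eventually.of_forall fun p => (norm_phase p.1 p.2.2).le)
  rw [intervalIntegral.integral_of_le hle, integral_integral_swap hprod]
  refine (enorm_integral_le_lintegral_enorm _).trans (lintegral_mono fun p => ?_)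
  simp only
  rw [integral_mul_const, enorm_mul, mul_comm, ← intervalIntegral.integral_of_le hle]
  gcongr
  exact enorm_integral_exp_le t₀ _ hδ hδ1

end Fubini

namespace AdmissibleLow

variable {N s : ℝ} {m : ℝ → ℝ}

theorem norm_iteratedDeriv_le (hN : 2 ≤ N) (h : AdmissibleLow N s m) :
    ∀ n ≤ 2, ∀ x, ‖iteratedDeriv n m x‖ ≤ 10 := by
  intro n hn x
  have hpos := h.pos hN x
  have hle := h.le_one hN x
  have hj := one_le_jap x
  interval_cases n
  · rw [iteratedDeriv_zero, norm_eq_abs, abs_of_pos hpos]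
    linarith
  · rw [iteratedDeriv_one, norm_eq_abs]
    refine (h.deriv1 x).trans ?_
    rw [div_le_iff₀ (by linarith)]
    nlinarith
  · rw [norm_eq_abs]
    refine (h.deriv2 x).trans ?_
    have := one_le_pow₀ (n := 2) hj
    rw [div_le_iff₀ (by linarith)]
    nlinarith

theorem stft_multX (hN : 2 ≤ N) (h : AdmissibleLow N s m) (g : SchwartzMap (ℝ × ℝ) ℂ) (ξ τ : ℝ) :
    stft (multX m fun x t => g (x, t)) ξ τ = m ξ * stft (fun x t => g (x, t)) ξ τ := by
  rw [stft_eq_integral_ft, stft_eq_integral_ft, ← integral_const_mul]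
  refine integral_congr_ae (Filter.Eventually.of_forall fun t => ?_)
  obtain ⟨f, hf⟩ := exists_schwartz_slice g t
  have := ft_mult h.smooth (h.norm_iteratedDeriv_le hN) f ξ
  rw [hf] at this
  change _ * ft (mult m fun x => g (x, t)) ξ = _
  rw [this]
  ring

end AdmissibleLow

theorem jap_sub_le (τ a : ℝ) : jap (τ - a) ≤ jap τ * jap a := by
  have h1 := abs_sub τ a
  have h2 := mul_nonneg (abs_nonneg τ) (abs_nonneg a)
  unfold jap
  nlinarith

theorem jap_sq_le (x : ℝ) : jap (x ^ 2) ≤ jap x ^ 2 := by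
  unfold jap
  rw [abs_pow]
  nlinarith [abs_nonneg x]

/-- The weighted `L²` norm on the Fourier side corresponding to `X^{1,1}`, with an additional
symbol `m`. -/
def fourierNorm (m : ℝ → ℝ) (V : ℝ → ℝ → ℂ) : ℝ≥0∞ :=
  (∫⁻ x, ∫⁻ τ, ENNReal.ofReal (m x * jap x * jap (τ - x ^ 2) * ‖V x τ‖) ^ 2) ^ (1 / 2 : ℝ)

theorem AdmissibleLow.fourierNorm_eq {N s : ℝ} {m : ℝ → ℝ} (hN : 2 ≤ N)
    (h : AdmissibleLow N s m) (g : SchwartzMap (ℝ × ℝ) ℂ) :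
    fourierNorm m (stft fun x t => g (x, t)) =
      ENNReal.ofReal (XsbNorm 1 (1 / 2 + 1 / 2) (multX m fun x t => g (x, t))) := by
  obtain ⟨hcont, C, hC, hdec⟩ := exists_stft_decay g 4
  set V := stft fun x t => g (x, t) with hV
  set F : ℝ × ℝ → ℝ := fun p =>
    (m p.1 * jap p.1 * jap (p.2 - p.1 ^ 2) * ‖V p.1 p.2‖) ^ 2 with hF
  have hFc : Continuous F := by
    have := h.smooth.continuous
    have := continuous_jap
    have : Continuous fun p : ℝ × ℝ => ‖V p.1 p.2‖ := hcont.norm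
    simp only [hF]
    fun_prop
  have hF0 : ∀ p, 0 ≤ F p := fun p => sq_nonneg _
  have hFi : Integrable F := by
    have hdom : Integrable (fun p : ℝ × ℝ => C ^ 2 * ((jap p.1 ^ 2)⁻¹ * (jap p.2 ^ 2)⁻¹)) :=
      (integrable_jap_inv_sq.mul_prod integrable_jap_inv_sq).const_mul _
    refine hdom.mono' hFc.aestronglyMeasurable (Filter.Eventually.of_forall fun p => ?_)
    obtain ⟨x, τ⟩ := p
    have hx := jap_pos x
    have ht := jap_pos τ
    have h1 : m x * jap x * jap (τ - x ^ 2) * ‖V x τ‖ * (jap x * jap τ) ≤ C := by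
      have e1 : jap (τ - x ^ 2) ≤ jap τ * jap x ^ 2 :=
        (jap_sub_le _ _).trans (by gcongr; exact jap_sq_le x)
      calc m x * jap x * jap (τ - x ^ 2) * ‖V x τ‖ * (jap x * jap τ)
          ≤ 1 * jap x * (jap τ * jap x ^ 2) * ‖V x τ‖ * (jap x * jap τ) := by
            have := (h.pos hN x).le
            have := h.le_one hN x
            have := (jap_pos (τ - x ^ 2)).le
            gcongr
        _ = jap x ^ 4 * jap τ ^ 2 * ‖V x τ‖ := by ring
        _ ≤ jap x ^ 4 * jap τ ^ 4 * ‖V x τ‖ := by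
            have := one_le_jap τ
            gcongr
            norm_num
        _ ≤ C := hdec x τ
    have h0 : 0 ≤ m x * jap x * jap (τ - x ^ 2) * ‖V x τ‖ * (jap x * jap τ) := by
      have := (h.pos hN x).le
      have := (jap_pos (τ - x ^ 2)).le
      positivity
    have h2 := pow_le_pow_left₀ h0 h1 2
    rw [norm_eq_abs, abs_of_nonneg (hF0 _)]
    simp only [hF]
    rw [← mul_inv, ← div_eq_mul_inv, le_div_iff₀ (by positivity)]
    calc _ = (m x * jap x * jap (τ - x ^ 2) * ‖V x τ‖ * (jap x * jap τ)) ^ 2 := by ring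
      _ ≤ _ := h2
  have hX : XsbNorm 1 (1 / 2 + 1 / 2) (multX m fun x t => g (x, t)) =
      (∫ p, F p) ^ (1 / 2 : ℝ) := by
    rw [XsbNorm, Measure.volume_eq_prod, integral_prod _ hFi]
    simp only [h.stft_multX hN, hF]
    congr 1
    refine integral_congr_ae (Filter.Eventually.of_forall fun x => ?_)
    refine integral_congr_ae (Filter.Eventually.of_forall fun τ => ?_)
    have e1 : (2 * 1 : ℝ) = (2 : ℕ) := by norm_num
    have e2 : (2 * (1 / 2 + 1 / 2) : ℝ) = (2 : ℕ) := by norm_num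
    simp only
    rw [e1, e2, rpow_natCast, rpow_natCast, norm_mul, Complex.norm_real, norm_eq_abs,
      mul_pow |m x|, sq_abs]
    ring
  rw [hX, fourierNorm, ← ENNReal.ofReal_rpow_of_nonneg (integral_nonneg hF0) (by norm_num),
    ofReal_integral_eq_lintegral_ofReal hFi (Filter.Eventually.of_forall hF0),
    Measure.volume_eq_prod, lintegral_prod _ (by fun_prop)]
  congr 1
  refine lintegral_congr fun x => lintegral_congr fun τ => ?_
  have : 0 ≤ m x * jap x * jap (τ - x ^ 2) * ‖V x τ‖ := by
    have := (h.pos hN x).le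
    have := (jap_pos (τ - x ^ 2)).le
    have := (jap_pos x).le
    positivity
  rw [← ENNReal.ofReal_pow this]

theorem spectralDecay_stft (g : SchwartzMap (ℝ × ℝ) ℂ) :
    SpectralDecay (stft fun x t => g (x, t)) := by
  obtain ⟨hcont, C, hC, hdec⟩ := exists_stft_decay g 4
  refine ⟨hcont, C, hC, fun x τ => ?_⟩
  have hx := jap_pos x
  have ht := jap_pos τ
  have h1 : jap x ^ 4 * jap τ ^ 2 * ‖stft (fun x t => g (x, t)) x τ‖ ≤ C := by
    refine le_trans ?_ (hdec x τ)
    have := one_le_jap τ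
    gcongr
    norm_num
  rw [← mul_inv, mul_assoc, ← mul_inv, ← div_eq_mul_inv, le_div_iff₀ (by positivity)]
  linarith

/-- The reflected conjugate `(x, τ) ↦ conj V(-x, -τ)`: the spacetime Fourier transform of `ū` when
`V` is that of `u`. -/
def reflectConj (V : ℝ → ℝ → ℂ) (x τ : ℝ) : ℂ := (starRingEnd ℂ) (V (-x) (-τ))

theorem SpectralDecay.reflectConj {V : ℝ → ℝ → ℂ} (h : SpectralDecay V) :
    SpectralDecay (reflectConj V) := by
  obtain ⟨hcont, C, hC, hdec⟩ := h
  refine ⟨Complex.continuous_conj.comp (hcont.comp (f := fun p : ℝ × ℝ => (-p.1, -p.2))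
    (by fun_prop)), C, hC, fun x τ => ?_⟩
  have := hdec (-x) (-τ)
  rwa [jap_neg, jap_neg, ← RCLike.norm_conj] at this

theorem ft_cj_eq_integral_reflectConj (g : SchwartzMap (ℝ × ℝ) ℂ) (ξ t : ℝ) :
    ft (cj fun x => g (x, t)) ξ = (2 * π)⁻¹ • ∫ τ : ℝ, Complex.exp (Complex.I * t * τ) *
      reflectConj (stft fun x t => g (x, t)) ξ τ := by
  rw [ft_cj, ft_eq_integral_stft, Complex.real_smul, map_mul, Complex.conj_ofReal,
    ← Complex.real_smul, ← integral_conj]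
  congr 1
  rw [← integral_neg_eq_self]
  refine integral_congr_ae (Filter.Eventually.of_forall fun τ => ?_)
  simp only [reflectConj, map_mul, ← Complex.exp_conj, Complex.conj_I, Complex.conj_ofReal]
  push_cast
  ring_nf

theorem lintegral_add_right_prod_four (F : ℝ × ℝ × ℝ × ℝ → ℝ≥0∞) (hF : Measurable F)
    (a b c d : ℝ) :
    ∫⁻ q : ℝ × ℝ × ℝ × ℝ, F (q.1 + a, q.2.1 + b, q.2.2.1 + c, q.2.2.2 + d) = ∫⁻ q, F q :=
  ((measurePreserving_add_right volume a).prod ((measurePreserving_add_right volume b).prod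
    ((measurePreserving_add_right volume c).prod
      (measurePreserving_add_right volume d)))).lintegral_comp hF

theorem lintegral_prod_mul_four {f₁ f₂ f₃ f₄ : ℝ → ℝ≥0∞} (h₁ : Measurable f₁) (h₂ : Measurable f₂)
    (h₃ : Measurable f₃) (h₄ : Measurable f₄) :
    ∫⁻ q : ℝ × ℝ × ℝ × ℝ, f₁ q.1 * (f₂ q.2.1 * (f₃ q.2.2.1 * f₄ q.2.2.2)) =
      (∫⁻ x, f₁ x) * ((∫⁻ x, f₂ x) * ((∫⁻ x, f₃ x) * ∫⁻ x, f₄ x)) := by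
  simp only [Measure.volume_eq_prod]
  rw [lintegral_prod_mul (f := f₁) (g := fun q : ℝ × ℝ × ℝ => f₂ q.1 * (f₃ q.2.1 * f₄ q.2.2))
      (by fun_prop) (by fun_prop),
    lintegral_prod_mul (f := f₂) (g := fun q : ℝ × ℝ => f₃ q.1 * f₄ q.2)
      (by fun_prop) (by fun_prop),
    lintegral_prod_mul (by fun_prop) (by fun_prop)]

theorem lintegral_prod_three (F : ℝ × ℝ × ℝ → ℝ≥0∞) (hF : Measurable F) :
    ∫⁻ x, F x = ∫⁻ x₁, ∫⁻ x₂, ∫⁻ x₃, F (x₁, x₂, x₃) := by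
  rw [Measure.volume_eq_prod, lintegral_prod _ hF.aemeasurable]
  refine lintegral_congr fun x₁ => ?_
  exact lintegral_prod _ (hF.comp measurable_prodMk_left).aemeasurable

/-- The total mass of the weight `⟨λ⟩^{-2}`. -/
def japMass : ℝ≥0∞ := ∫⁻ x, ENNReal.ofReal (jap x)⁻¹ ^ 2

theorem japMass_ne_top : japMass ≠ ∞ := by
  have h := integrable_jap_inv_sq.lintegral_lt_top
  refine (lt_of_eq_of_lt ?_ h).ne
  refine lintegral_congr fun x => ?_
  rw [← ENNReal.ofReal_pow (inv_nonneg.2 (jap_pos x).le), inv_pow]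

theorem measurable_l2 {α : Type*} [MeasurableSpace α] {G : α → ℝ → ℝ≥0∞}
    (hG : Measurable fun p : α × ℝ => G p.1 p.2) : Measurable fun a => l2 (G a) :=
  (Measurable.lintegral_prod_right' (f := fun p : α × ℝ => G p.1 p.2 ^ 2)
    (hG.pow_const 2)).pow_const _

/-- Foliation over translated parabolas: the `L¹` norm in the modulation of the `L²` norms of the
leaves is controlled by a weighted `L²` norm. -/
theorem lintegral_l2_le {G : ℝ → ℝ → ℝ≥0∞} (hG : Measurable fun p : ℝ × ℝ => G p.1 p.2)
    {σ : ℝ → ℝ} (hσ : Measurable σ) :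
    ∫⁻ l, l2 (fun x => G x (l + σ x)) ≤ japMass ^ (1 / 2 : ℝ) *
      (∫⁻ x, ∫⁻ τ, (ENNReal.ofReal (jap (τ - σ x)) * G x τ) ^ 2) ^ (1 / 2 : ℝ) := by
  have hj : Measurable jap := continuous_jap.measurable
  have hG' : Measurable fun p : ℝ × ℝ => G p.2 (p.1 + σ p.2) :=
    hG.comp (by fun_prop : Measurable fun p : ℝ × ℝ => (p.2, p.1 + σ p.2))
  have hl := measurable_l2 (G := fun l x => G x (l + σ x)) hG'
  have hone : ∀ l : ℝ, ENNReal.ofReal (jap l)⁻¹ * ENNReal.ofReal (jap l) = 1 := fun l => by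
    rw [← ENNReal.ofReal_mul (inv_nonneg.2 (jap_pos l).le), inv_mul_cancel₀ (jap_pos l).ne',
      ENNReal.ofReal_one]
  calc ∫⁻ l, l2 (fun x => G x (l + σ x))
      = ∫⁻ l, ENNReal.ofReal (jap l)⁻¹ * (ENNReal.ofReal (jap l) * l2 fun x => G x (l + σ x)) := by
        refine lintegral_congr fun l => ?_
        rw [← mul_assoc, hone, one_mul]
    _ ≤ (∫⁻ l, ENNReal.ofReal (jap l)⁻¹ ^ 2) ^ (1 / 2 : ℝ) *
        (∫⁻ l, (ENNReal.ofReal (jap l) * l2 fun x => G x (l + σ x)) ^ 2) ^ (1 / 2 : ℝ) :=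
        lintegral_mul_le_sqrt (by fun_prop) (by fun_prop)
    _ = _ := by
        congr 2
        calc ∫⁻ l, (ENNReal.ofReal (jap l) * l2 fun x => G x (l + σ x)) ^ 2
            = ∫⁻ l, ∫⁻ x, (ENNReal.ofReal (jap l) * G x (l + σ x)) ^ 2 := by
              refine lintegral_congr fun l => ?_
              have : Measurable fun x => G x (l + σ x) :=
                hG'.comp (measurable_prodMk_left (x := l))
              simp_rw [mul_pow]
              rw [lintegral_const_mul _ (by fun_prop), l2, ← ENNReal.rpow_mul_natCast]
              norm_num
          _ = ∫⁻ x, ∫⁻ l, (ENNReal.ofReal (jap l) * G x (l + σ x)) ^ 2 :=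
              lintegral_lintegral_swap (Measurable.aemeasurable
                (((ENNReal.measurable_ofReal.comp (hj.comp measurable_fst)).mul hG').pow_const 2))
          _ = _ := by
              refine lintegral_congr fun x => ?_
              rw [← lintegral_add_right_eq_self
                (fun τ => (ENNReal.ofReal (jap (τ - σ x)) * G x τ) ^ 2) (σ x)]
              simp only [add_sub_cancel_right]

/-- The quadrilinear spacetime estimate. -/
theorem lintegral_prod_timeKernel_le {G₁ G₂ G₃ G₄ : ℝ → ℝ → ℝ≥0∞}
    (h₁ : Measurable fun p : ℝ × ℝ => G₁ p.1 p.2) (h₂ : Measurable fun p : ℝ × ℝ => G₂ p.1 p.2)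
    (h₃ : Measurable fun p : ℝ × ℝ => G₃ p.1 p.2) (h₄ : Measurable fun p : ℝ × ℝ => G₄ p.1 p.2) :
    ∫⁻ p : (ℝ × ℝ × ℝ) × (ℝ × ℝ × ℝ × ℝ), G₁ p.1.1 p.2.1 * G₂ p.1.2.1 p.2.2.1 *
        G₃ p.1.2.2 p.2.2.2.1 * G₄ (-(p.1.1 + p.1.2.1 + p.1.2.2)) p.2.2.2.2 *
        timeKernel (p.2.1 + p.2.2.1 + p.2.2.2.1 + p.2.2.2.2) ≤
      quadConst * ((∫⁻ l, l2 fun x => G₁ x (l + x ^ 2)) * ((∫⁻ l, l2 fun x => G₂ x (l + -x ^ 2)) *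
        ((∫⁻ l, l2 fun x => G₃ x (l + x ^ 2)) * ∫⁻ l, l2 fun x => G₄ x (l + -x ^ 2)))) := by
  have hk := measurable_timeKernel
  have hF : Measurable fun p : (ℝ × ℝ × ℝ) × (ℝ × ℝ × ℝ × ℝ) => G₁ p.1.1 p.2.1 *
      G₂ p.1.2.1 p.2.2.1 * G₃ p.1.2.2 p.2.2.2.1 *
      G₄ (-(p.1.1 + p.1.2.1 + p.1.2.2)) p.2.2.2.2 *
      timeKernel (p.2.1 + p.2.2.1 + p.2.2.2.1 + p.2.2.2.2) := by
    have c₁ := h₁.comp (by fun_prop : Measurable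
      fun p : (ℝ × ℝ × ℝ) × (ℝ × ℝ × ℝ × ℝ) => (p.1.1, p.2.1))
    have c₂ := h₂.comp (by fun_prop : Measurable
      fun p : (ℝ × ℝ × ℝ) × (ℝ × ℝ × ℝ × ℝ) => (p.1.2.1, p.2.2.1))
    have c₃ := h₃.comp (by fun_prop : Measurable
      fun p : (ℝ × ℝ × ℝ) × (ℝ × ℝ × ℝ × ℝ) => (p.1.2.2, p.2.2.2.1))
    have c₄ := h₄.comp (by fun_prop : Measurable
      fun p : (ℝ × ℝ × ℝ) × (ℝ × ℝ × ℝ × ℝ) => (-(p.1.1 + p.1.2.1 + p.1.2.2), p.2.2.2.2))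
    exact (((c₁.mul c₂).mul c₃).mul c₄).mul (hk.comp (by fun_prop))
  have hS : Measurable fun p : (ℝ × ℝ × ℝ) × (ℝ × ℝ × ℝ × ℝ) =>
      (p.1, (p.2.1 + p.1.1 ^ 2, p.2.2.1 + -p.1.2.1 ^ 2, p.2.2.2.1 + p.1.2.2 ^ 2,
        p.2.2.2.2 + -(-(p.1.1 + p.1.2.1 + p.1.2.2)) ^ 2)) := by fun_prop
  have hFS := hF.comp hS
  have m₁ : Measurable fun l => l2 fun x => G₁ x (l + x ^ 2) := measurable_l2
    (G := fun l x => G₁ x (l + x ^ 2))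
    (h₁.comp (by fun_prop : Measurable fun p : ℝ × ℝ => (p.2, p.1 + p.2 ^ 2)))
  have m₂ : Measurable fun l => l2 fun x => G₂ x (l + -x ^ 2) := measurable_l2
    (G := fun l x => G₂ x (l + -x ^ 2))
    (h₂.comp (by fun_prop : Measurable fun p : ℝ × ℝ => (p.2, p.1 + -p.2 ^ 2)))
  have m₃ : Measurable fun l => l2 fun x => G₃ x (l + x ^ 2) := measurable_l2
    (G := fun l x => G₃ x (l + x ^ 2))
    (h₃.comp (by fun_prop : Measurable fun p : ℝ × ℝ => (p.2, p.1 + p.2 ^ 2)))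
  have m₄ : Measurable fun l => l2 fun x => G₄ x (l + -x ^ 2) := measurable_l2
    (G := fun l x => G₄ x (l + -x ^ 2))
    (h₄.comp (by fun_prop : Measurable fun p : ℝ × ℝ => (p.2, p.1 + -p.2 ^ 2)))
  rw [← lintegral_prod_mul_four m₁ m₂ m₃ m₄, ← lintegral_const_mul' _ _ quadConst_ne_top]
  rw [Measure.volume_eq_prod, lintegral_prod _ hF.aemeasurable]
  have hshift : ∀ x : ℝ × ℝ × ℝ, ∫⁻ q : ℝ × ℝ × ℝ × ℝ, G₁ x.1 q.1 * G₂ x.2.1 q.2.1 *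
      G₃ x.2.2 q.2.2.1 * G₄ (-(x.1 + x.2.1 + x.2.2)) q.2.2.2 *
      timeKernel (q.1 + q.2.1 + q.2.2.1 + q.2.2.2) =
      ∫⁻ q : ℝ × ℝ × ℝ × ℝ, G₁ x.1 (q.1 + x.1 ^ 2) * G₂ x.2.1 (q.2.1 + -x.2.1 ^ 2) *
      G₃ x.2.2 (q.2.2.1 + x.2.2 ^ 2) *
      G₄ (-(x.1 + x.2.1 + x.2.2)) (q.2.2.2 + -(-(x.1 + x.2.1 + x.2.2)) ^ 2) *
      timeKernel (q.1 + x.1 ^ 2 + (q.2.1 + -x.2.1 ^ 2) + (q.2.2.1 + x.2.2 ^ 2) +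
        (q.2.2.2 + -(-(x.1 + x.2.1 + x.2.2)) ^ 2)) := fun x =>
    (lintegral_add_right_prod_four _ (hF.comp (measurable_prodMk_left (x := x))) _ _ _ _).symm
  simp only [hshift]
  refine (lintegral_lintegral_swap ?_).trans_le (lintegral_mono fun q => ?_)
  · exact hFS.aemeasurable
  have hFq := hFS.comp (measurable_prodMk_right (y := q))
  have g₁ : Measurable fun x => G₁ x (q.1 + x ^ 2) :=
    h₁.comp (by fun_prop : Measurable fun x : ℝ => (x, q.1 + x ^ 2))
  have g₂ : Measurable fun x => G₂ x (q.2.1 + -x ^ 2) :=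
    h₂.comp (by fun_prop : Measurable fun x : ℝ => (x, q.2.1 + -x ^ 2))
  have g₃ : Measurable fun x => G₃ x (q.2.2.1 + x ^ 2) :=
    h₃.comp (by fun_prop : Measurable fun x : ℝ => (x, q.2.2.1 + x ^ 2))
  have g₄ : Measurable fun x => G₄ x (q.2.2.2 + -x ^ 2) :=
    h₄.comp (by fun_prop : Measurable fun x : ℝ => (x, q.2.2.2 + -x ^ 2))
  have hquad := quadrilinear_estimate g₁ g₂ g₃ g₄ (q.1 + q.2.1 + q.2.2.1 + q.2.2.2)
  simp only [mul_assoc (l2 _)] at hquad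
  refine (lintegral_prod_three _ hFq).trans_le (le_trans (le_of_eq ?_) hquad)
  refine lintegral_congr fun x₁ => lintegral_congr fun x₂ => lintegral_congr fun x₃ => ?_
  simp only [Function.comp_apply]
  congr 2
  ring

section Weighted

variable {m : ℝ → ℝ} {V : ℝ → ℝ → ℂ}

theorem measurable_ofReal_weight (hm : Continuous m) (hV : SpectralDecay V) :
    Measurable fun p : ℝ × ℝ => ENNReal.ofReal (m p.1 * jap p.1 * ‖V p.1 p.2‖) := by
  have h1 : Continuous fun p : ℝ × ℝ => ‖V p.1 p.2‖ := hV.cont.norm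
  have h2 := continuous_jap
  have h3 : Continuous fun p : ℝ × ℝ => m p.1 * jap p.1 * ‖V p.1 p.2‖ := by fun_prop
  exact h3.measurable.ennreal_ofReal

theorem ofReal_jap_mul (a x τ : ℝ) :
    ENNReal.ofReal (jap a) * ENNReal.ofReal (m x * jap x * ‖V x τ‖) =
      ENNReal.ofReal (m x * jap x * jap a * ‖V x τ‖) := by
  rw [← ENNReal.ofReal_mul (jap_pos a).le]
  ring_nf

theorem lintegral_l2_add_sq_le (hm : Continuous m) (hV : SpectralDecay V) :
    ∫⁻ l, l2 (fun x => ENNReal.ofReal (m x * jap x * ‖V x (l + x ^ 2)‖)) ≤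
      japMass ^ (1 / 2 : ℝ) * fourierNorm m V := by
  refine (lintegral_l2_le
    (G := fun x τ => ENNReal.ofReal (m x * jap x * ‖V x τ‖)) (measurable_ofReal_weight hm hV)
    (σ := fun x => x ^ 2) (by fun_prop)).trans (le_of_eq ?_)
  simp only [ofReal_jap_mul, fourierNorm]

theorem lintegral_l2_sub_sq_le (hm : Continuous m) (heven : ∀ x, m (-x) = m x)
    (hV : SpectralDecay V) :
    ∫⁻ l, l2 (fun x => ENNReal.ofReal (m x * jap x * ‖reflectConj V x (l + -x ^ 2)‖)) ≤
      japMass ^ (1 / 2 : ℝ) * fourierNorm m V := by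
  refine (lintegral_l2_le
    (G := fun x τ => ENNReal.ofReal (m x * jap x * ‖reflectConj V x τ‖))
    (measurable_ofReal_weight hm hV.reflectConj)
    (σ := fun x => -x ^ 2) (by fun_prop)).trans (le_of_eq ?_)
  simp only [ofReal_jap_mul, fourierNorm]
  congr 2
  rw [← lintegral_neg_eq_self]
  refine lintegral_congr fun x => ?_
  rw [← lintegral_neg_eq_self]
  refine lintegral_congr fun τ => ?_
  have : -τ - -(-x) ^ 2 = -(τ - x ^ 2) := by ring
  simp only [reflectConj, heven, jap_neg, neg_neg, RCLike.norm_conj, this]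

end Weighted

/-- The symbol `M₄'` restricted to the hyperplane. -/
def hyperSymbol (m : ℝ → ℝ) (x : ℝ × ℝ × ℝ) : ℝ :=
  x.1 ^ 2 * m x.1 * (m x.2.1 * m x.2.2 * m (-(x.1 + x.2.1 + x.2.2)) -
    m (x.2.1 + x.2.2 + -(x.1 + x.2.1 + x.2.2)))

namespace AdmissibleLow

variable {N s : ℝ} {m : ℝ → ℝ}

theorem continuous_hyperSymbol (h : AdmissibleLow N s m) : Continuous (hyperSymbol m) := by
  have := h.smooth.continuous
  unfold hyperSymbol
  fun_prop

theorem abs_hyperSymbol_le (hN : 2 ≤ N) (h : AdmissibleLow N s m) (x : ℝ × ℝ × ℝ) :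
    |hyperSymbol m x| ≤ 1 * jap x.1 ^ 2 := by
  have hm : ∀ y, |m y| ≤ 1 := fun y => by
    rw [abs_of_pos (h.pos hN y)]
    exact h.le_one hN y
  have hprod : 0 ≤ m x.2.1 * m x.2.2 * m (-(x.1 + x.2.1 + x.2.2)) ∧
      m x.2.1 * m x.2.2 * m (-(x.1 + x.2.1 + x.2.2)) ≤ 1 := by
    have h1 := h.pos hN x.2.1
    have h2 := h.pos hN x.2.2
    have h3 := h.pos hN (-(x.1 + x.2.1 + x.2.2))
    exact ⟨by positivity, mul_le_one₀ (mul_le_one₀ (h.le_one hN _) h2.le (h.le_one hN _)) h3.le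
      (h.le_one hN _)⟩
  have hlast := h.pos hN (x.2.1 + x.2.2 + -(x.1 + x.2.1 + x.2.2))
  have hlast' := h.le_one hN (x.2.1 + x.2.2 + -(x.1 + x.2.1 + x.2.2))
  have hdiff : |m x.2.1 * m x.2.2 * m (-(x.1 + x.2.1 + x.2.2)) -
      m (x.2.1 + x.2.2 + -(x.1 + x.2.1 + x.2.2))| ≤ 1 := by
    rw [abs_le]
    constructor <;> linarith [hprod.1, hprod.2]
  have hx : |x.1 ^ 2| ≤ jap x.1 ^ 2 := by
    rw [abs_pow]
    unfold jap
    gcongr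
    linarith
  rw [hyperSymbol, abs_mul, abs_mul]
  calc |x.1 ^ 2| * |m x.1| * _ ≤ jap x.1 ^ 2 * 1 * 1 := by
        gcongr
        exact hm _
    _ = _ := by ring

theorem enorm_density_le (hN : 2 ≤ N) (h : AdmissibleLow N s m) (V₁ V₂ V₃ V₄ : ℝ → ℝ → ℂ)
    (p : (ℝ × ℝ × ℝ) × (ℝ × ℝ × ℝ × ℝ)) :
    ‖density (hyperSymbol m) V₁ V₂ V₃ V₄ p‖ₑ ≤ ENNReal.ofReal (720 / N) *
      (ENNReal.ofReal (m p.1.1 * jap p.1.1 * ‖V₁ p.1.1 p.2.1‖) *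
        ENNReal.ofReal (m p.1.2.1 * jap p.1.2.1 * ‖V₂ p.1.2.1 p.2.2.1‖) *
        ENNReal.ofReal (m p.1.2.2 * jap p.1.2.2 * ‖V₃ p.1.2.2 p.2.2.2.1‖) *
        ENNReal.ofReal (m (-(p.1.1 + p.1.2.1 + p.1.2.2)) * jap (-(p.1.1 + p.1.2.1 + p.1.2.2)) *
          ‖V₄ (-(p.1.1 + p.1.2.1 + p.1.2.2)) p.2.2.2.2‖)) := by
  obtain ⟨⟨x₁, x₂, x₃⟩, t₁, t₂, t₃, t₄⟩ := p
  have hw : ∀ x (V : ℝ → ℝ → ℂ) t, 0 ≤ m x * jap x * ‖V x t‖ := fun x V t => by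
    have := h.pos hN x
    have := jap_pos x
    positivity
  have hb := h.symbol_bound hN (x₁ := x₁) (x₂ := x₂) (x₃ := x₃) (x₄ := -(x₁ + x₂ + x₃)) (by ring)
  rw [abs_mul, abs_mul] at hb
  have h1 := hw x₁ V₁ t₁
  have h2 := hw x₂ V₂ t₂
  have h3 := hw x₃ V₃ t₃
  simp only
  rw [← ENNReal.ofReal_mul h1, ← ENNReal.ofReal_mul (by positivity),
    ← ENNReal.ofReal_mul (by positivity), ← ENNReal.ofReal_mul (by positivity), ← ofReal_norm]
  refine ENNReal.ofReal_le_ofReal ?_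
  simp only [density, hyperSymbol, norm_mul, Complex.norm_real, norm_eq_abs]
  refine (mul_le_mul_of_nonneg_right hb (by positivity : 0 ≤ ‖V₁ x₁ t₁‖ * (‖V₂ x₂ t₂‖ *
    (‖V₃ x₃ t₃‖ * ‖V₄ (-(x₁ + x₂ + x₃)) t₄‖)))).trans (le_of_eq ?_)
  ring

theorem lintegral_density_le (hN : 2 ≤ N) (h : AdmissibleLow N s m) {V₁ V₂ V₃ V₄ : ℝ → ℝ → ℂ}
    (h₁ : SpectralDecay V₁) (h₂ : SpectralDecay V₂) (h₃ : SpectralDecay V₃)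
    (h₄ : SpectralDecay V₄) :
    ∫⁻ p, ‖density (hyperSymbol m) V₁ (reflectConj V₂) V₃ (reflectConj V₄) p‖ₑ *
        (3 * timeKernel (p.2.1 + p.2.2.1 + p.2.2.2.1 + p.2.2.2.2)) ≤
      ENNReal.ofReal (1 / N) * (2160 * quadConst * japMass ^ 2) *
        (fourierNorm m V₁ * fourierNorm m V₂ * fourierNorm m V₃ * fourierNorm m V₄) := by
  have hm := h.smooth.continuous
  have hsq : japMass ^ (1 / 2 : ℝ) * japMass ^ (1 / 2 : ℝ) = japMass := by
    rw [← ENNReal.rpow_add_of_nonneg _ _ (by norm_num) (by norm_num)]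
    norm_num
  have hN' : ENNReal.ofReal (720 / N) * 3 = ENNReal.ofReal (1 / N) * 2160 := by
    rw [show (3 : ℝ≥0∞) = ENNReal.ofReal 3 by simp, show (2160 : ℝ≥0∞) = ENNReal.ofReal 2160 by simp,
      ← ENNReal.ofReal_mul (by positivity), ← ENNReal.ofReal_mul (by positivity)]
    ring_nf
  calc _ ≤ ∫⁻ p : (ℝ × ℝ × ℝ) × (ℝ × ℝ × ℝ × ℝ), (ENNReal.ofReal (1 / N) * 2160) *
      (ENNReal.ofReal (m p.1.1 * jap p.1.1 * ‖V₁ p.1.1 p.2.1‖) *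
        ENNReal.ofReal (m p.1.2.1 * jap p.1.2.1 * ‖reflectConj V₂ p.1.2.1 p.2.2.1‖) *
        ENNReal.ofReal (m p.1.2.2 * jap p.1.2.2 * ‖V₃ p.1.2.2 p.2.2.2.1‖) *
        ENNReal.ofReal (m (-(p.1.1 + p.1.2.1 + p.1.2.2)) * jap (-(p.1.1 + p.1.2.1 + p.1.2.2)) *
          ‖reflectConj V₄ (-(p.1.1 + p.1.2.1 + p.1.2.2)) p.2.2.2.2‖) *
        timeKernel (p.2.1 + p.2.2.1 + p.2.2.2.1 + p.2.2.2.2)) := by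
        refine lintegral_mono fun p => ?_
        rw [← hN']
        refine (mul_le_mul_left (h.enorm_density_le hN V₁ (reflectConj V₂) V₃ (reflectConj V₄) p)
          _).trans (le_of_eq ?_)
        ring
    _ = ENNReal.ofReal (1 / N) * 2160 * _ :=
        lintegral_const_mul' _ _ (ENNReal.mul_ne_top ENNReal.ofReal_ne_top (by norm_num))
    _ ≤ ENNReal.ofReal (1 / N) * 2160 * (quadConst * ((japMass ^ (1 / 2 : ℝ) * fourierNorm m V₁) *
          ((japMass ^ (1 / 2 : ℝ) * fourierNorm m V₂) * ((japMass ^ (1 / 2 : ℝ) *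
            fourierNorm m V₃) * (japMass ^ (1 / 2 : ℝ) * fourierNorm m V₄))))) := by
        gcongr
        refine (lintegral_prod_timeKernel_le
          (G₁ := fun x τ => ENNReal.ofReal (m x * jap x * ‖V₁ x τ‖))
          (G₂ := fun x τ => ENNReal.ofReal (m x * jap x * ‖reflectConj V₂ x τ‖))
          (G₃ := fun x τ => ENNReal.ofReal (m x * jap x * ‖V₃ x τ‖))
          (G₄ := fun x τ => ENNReal.ofReal (m x * jap x * ‖reflectConj V₄ x τ‖))
          (measurable_ofReal_weight hm h₁) (measurable_ofReal_weight hm h₂.reflectConj)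
          (measurable_ofReal_weight hm h₃) (measurable_ofReal_weight hm h₄.reflectConj)).trans ?_
        gcongr
        · exact lintegral_l2_add_sq_le hm h₁
        · exact lintegral_l2_sub_sq_le hm h.even h₂
        · exact lintegral_l2_add_sq_le hm h₃
        · exact lintegral_l2_sub_sq_le hm h.even h₄
    _ = ENNReal.ofReal (1 / N) * (2160 * quadConst *
          ((japMass ^ (1 / 2 : ℝ) * japMass ^ (1 / 2 : ℝ)) ^ 2)) *
          (fourierNorm m V₁ * fourierNorm m V₂ * fourierNorm m V₃ * fourierNorm m V₄) := by ring
    _ = _ := by rw [hsq]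

theorem enorm_integral_Lam4_le (hN : 2 ≤ N) (h : AdmissibleLow N s m) {δ : ℝ} (t₀ : ℝ) (hδ : 0 < δ)
    (hδ1 : δ ≤ 1) (g₁ g₂ g₃ g₄ : SchwartzMap (ℝ × ℝ) ℂ) :
    ‖∫ t in t₀..(t₀ + δ),
        Lam4 (fun ξ₁ ξ₂ ξ₃ ξ₄ => ξ₁ ^ 2 * m ξ₁ * (m ξ₂ * m ξ₃ * m ξ₄ - m (ξ₂ + ξ₃ + ξ₄)))
          (fun x => g₁ (x, t)) (cj fun x => g₂ (x, t)) (fun x => g₃ (x, t))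
          (cj fun x => g₄ (x, t))‖ₑ ≤
      ENNReal.ofReal (1 / N) * (2160 * quadConst * japMass ^ 2) *
        (fourierNorm m (stft fun x t => g₁ (x, t)) * fourierNorm m (stft fun x t => g₂ (x, t)) *
          fourierNorm m (stft fun x t => g₃ (x, t)) *
          fourierNorm m (stft fun x t => g₄ (x, t))) := by
  have h₁ := spectralDecay_stft g₁
  have h₂ := spectralDecay_stft g₂
  have h₃ := spectralDecay_stft g₃
  have h₄ := spectralDecay_stft g₄
  have hi := integrable_density h.continuous_hyperSymbol (h.abs_hyperSymbol_le hN) h₁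
    h₂.reflectConj h₃ h₄.reflectConj
  have hLam := fun t => Lam4_eq_integral_density
    (M := fun ξ₁ ξ₂ ξ₃ ξ₄ => ξ₁ ^ 2 * m ξ₁ * (m ξ₂ * m ξ₃ * m ξ₄ - m (ξ₂ + ξ₃ + ξ₄)))
    (fun _ _ _ => rfl) hi t (fun ξ => ft_eq_integral_stft g₁ ξ t)
    (fun ξ => ft_cj_eq_integral_reflectConj g₂ ξ t) (fun ξ => ft_eq_integral_stft g₃ ξ t)
    (fun ξ => ft_cj_eq_integral_reflectConj g₄ ξ t)
  simp only [hLam]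
  rw [intervalIntegral.integral_const_mul, enorm_mul]
  refine le_trans (mul_le_of_le_one_left zero_le ?_)
    ((enorm_integral_phase_density_le hi t₀ hδ hδ1).trans (h.lintegral_density_le hN h₁ h₂ h₃ h₄))
  rw [← ofReal_norm, Complex.norm_real, norm_eq_abs, abs_of_nonneg (by positivity),
    ENNReal.ofReal_le_one]
  exact pow_le_one₀ (by positivity) (inv_le_one_of_one_le₀ (by linarith [pi_gt_three]))

end AdmissibleLow

/-- the `Λ₄` estimate with symbol `M₄'`. -/
theorem lambda4_Mprime_estimate
    (s ε : ℝ) (hs0 : 0 ≤ s) (hs1 : s < 1) (hε : 0 < ε) :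
    ∃ ε' C : ℝ, 0 < ε' ∧ 0 < C ∧
      ∀ N : ℝ, 2 ≤ N → ∀ m : ℝ → ℝ, AdmissibleLow N s m →
      ∀ t₀ δ : ℝ, 0 < δ → δ ≤ 1 →
      ∀ u₁ u₂ u₃ u₄ : ℝ → ℝ → ℂ,
      IsSchwartz2 u₁ → IsSchwartz2 u₂ → IsSchwartz2 u₃ → IsSchwartz2 u₄ →
      ‖∫ t in t₀..(t₀ + δ),
          Lam4 (fun ξ₁ ξ₂ ξ₃ ξ₄ => ξ₁ ^ 2 * m ξ₁ * (m ξ₂ * m ξ₃ * m ξ₄ - m (ξ₂ + ξ₃ + ξ₄)))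
            (fun x => u₁ x t) (cj fun x => u₂ x t) (fun x => u₃ x t) (cj fun x => u₄ x t)‖
        ≤ C * N ^ (-1 + ε) * (XsbNorm 1 (1 / 2 + ε') (multX m u₁)
          * XsbNorm 1 (1 / 2 + ε') (multX m u₂) * XsbNorm 1 (1 / 2 + ε') (multX m u₃)
          * XsbNorm 1 (1 / 2 + ε') (multX m u₄)) := by
  have hK0 : 0 ≤ (2160 * quadConst * japMass ^ 2).toReal := ENNReal.toReal_nonneg
  have hKtop : 2160 * quadConst * japMass ^ 2 ≠ ∞ :=
    ENNReal.mul_ne_top (ENNReal.mul_ne_top (by norm_num) quadConst_ne_top)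
      (ENNReal.pow_ne_top japMass_ne_top)
  refine ⟨1 / 2, (2160 * quadConst * japMass ^ 2).toReal + 1, by norm_num, by linarith, ?_⟩
  intro N hN m h t₀ δ hδ hδ1 u₁ u₂ u₃ u₄ ⟨g₁, hg₁⟩ ⟨g₂, hg₂⟩ ⟨g₃, hg₃⟩ ⟨g₄, hg₄⟩
  obtain rfl : u₁ = fun x t => g₁ (x, t) := funext₂ hg₁
  obtain rfl : u₂ = fun x t => g₂ (x, t) := funext₂ hg₂
  obtain rfl : u₃ = fun x t => g₃ (x, t) := funext₂ hg₃
  obtain rfl : u₄ = fun x t => g₄ (x, t) := funext₂ hg₄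
  have hmain := h.enorm_integral_Lam4_le hN t₀ hδ hδ1 g₁ g₂ g₃ g₄
  simp only [h.fourierNorm_eq hN] at hmain
  have hX : ∀ u : ℝ → ℝ → ℂ, 0 ≤ XsbNorm 1 (1 / 2 + 1 / 2) u := fun u =>
    rpow_nonneg (integral_nonneg fun ξ => integral_nonneg fun τ => by
      have := jap_pos ξ
      have := jap_pos (τ - ξ ^ 2)
      positivity) _
  set X₁ := XsbNorm 1 (1 / 2 + 1 / 2) (multX m fun x t => g₁ (x, t))
  set X₂ := XsbNorm 1 (1 / 2 + 1 / 2) (multX m fun x t => g₂ (x, t))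
  set X₃ := XsbNorm 1 (1 / 2 + 1 / 2) (multX m fun x t => g₃ (x, t))
  set X₄ := XsbNorm 1 (1 / 2 + 1 / 2) (multX m fun x t => g₄ (x, t))
  have h1 : 0 ≤ X₁ := hX _
  have h2 : 0 ≤ X₂ := hX _
  have h3 : 0 ≤ X₃ := hX _
  have h4 : 0 ≤ X₄ := hX _
  have hN0 : 0 < N := by linarith
  rw [← ENNReal.ofReal_toReal hKtop, ← ENNReal.ofReal_mul h1, ← ENNReal.ofReal_mul (by positivity),
    ← ENNReal.ofReal_mul (by positivity), ← ENNReal.ofReal_mul (by positivity),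
    ← ENNReal.ofReal_mul (by positivity), ← ofReal_norm,
    ENNReal.ofReal_le_ofReal_iff (by positivity)] at hmain
  refine hmain.trans ?_
  have hpow : 1 / N ≤ N ^ (-1 + ε) := by
    rw [one_div, ← rpow_neg_one]
    exact rpow_le_rpow_of_exponent_le (by linarith) (by linarith)
  rw [mul_comm (1 / N)]
  gcongr
  linarith
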